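/- (Theorem 4) Consider the generalized Dueck DMBC with noiseless feedback, and assume H(Z₀,Z₁) ≤ 1 and H(Z₀,Z₂) ≤ 1. Then the zero-common-rate slice of the noiseless-feedback capacity region, {(R₁,R₂) : (0,R₁,R₂) ∈ C_NoiselessFB}, equals the set of all nonnegative pairs (R₁,R₂) satisfying R₁ ≤ 2 − H(Z₀,Z₁), R₂ ≤ 2 − H(Z₀,Z₂), and R₁+R₂ ≤ 3 − H(Z₀,Z₁,Z₂). -/

import Mathlib

open scoped BigOperators Classical

noncomputable section

namespace BCFB

variable {Ω A B C : Type*}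

/-- Probability of an event under a weight function on a finite sample space. -/
def prOf [Fintype Ω] (w : Ω → ℝ) (E : Ω → Prop) : ℝ :=
  ∑ ω, if E ω then w ω else 0

/-- Distribution (pushforward) of a random variable. -/
def distOf [Fintype Ω] (w : Ω → ℝ) (X : Ω → A) : A → ℝ :=
  fun a => prOf w fun ω => X ω = a

/-- Shannon entropy (base 2) of a random variable. -/
def entOf [Fintype Ω] [Fintype A] (w : Ω → ℝ) (X : Ω → A) : ℝ :=
  -∑ a, distOf w X a * Real.logb 2 (distOf w X a)

/-- Mutual information (base 2). -/
def miOf [Fintype Ω] [Fintype A] [Fintype B] (w : Ω → ℝ) (X : Ω → A) (Y : Ω → B) : ℝ :=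
  entOf w X + entOf w Y - entOf w fun ω => (X ω, Y ω)

/-- Conditional mutual information I(X;Y|Z) (base 2). -/
def cmiOf [Fintype Ω] [Fintype A] [Fintype B] [Fintype C]
    (w : Ω → ℝ) (X : Ω → A) (Y : Ω → B) (Z : Ω → C) : ℝ :=
  entOf w (fun ω => (X ω, Z ω)) + entOf w (fun ω => (Y ω, Z ω))
    - entOf w (fun ω => (X ω, Y ω, Z ω)) - entOf w Z

/-- `w` is a probability mass function. -/
def IsPMF [Fintype Ω] (w : Ω → ℝ) : Prop := (∀ ω, 0 ≤ w ω) ∧ ∑ ω, w ω = 1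

/-- `k` is a transition kernel (each row a pmf). -/
def IsKernel {A B : Type*} [Fintype A] [Fintype B] (k : A → B → ℝ) : Prop :=
  ∀ a, IsPMF (k a)

/-- `X — Y — Z` forms a Markov chain (i.e. `X` and `Z` are conditionally
independent given `Y`). -/
def MarkovChain [Fintype Ω] (w : Ω → ℝ) (X : Ω → A) (Y : Ω → B) (Z : Ω → C) : Prop :=
  ∀ a b c,
    distOf w (fun ω => (X ω, Y ω, Z ω)) (a, b, c) * distOf w Y b
      = distOf w (fun ω => (X ω, Y ω)) (a, b) * distOf w (fun ω => (Z ω, Y ω)) (c, b)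

/-- `X` and `Y` are independent. -/
def IndepRV [Fintype Ω] (w : Ω → ℝ) (X : Ω → A) (Y : Ω → B) : Prop :=
  ∀ a b, distOf w (fun ω => (X ω, Y ω)) (a, b) = distOf w X a * distOf w Y b

/-- Number of messages of rate `R` and blocklength `n`: `⌊2^{nR}⌋`. -/
def msgCard (n : ℕ) (R : ℝ) : ℕ := ⌊(2 : ℝ) ^ ((n : ℝ) * R)⌋₊

/-- Binary entropy function. -/
def hb (u : ℝ) : ℝ := -(u * Real.logb 2 u) - (1 - u) * Real.logb 2 (1 - u)

/-- Empirical frequency of the letter `a` in the sequence `x`. -/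
def freqOf {A : Type*} {n : ℕ} (x : Fin n → A) (a : A) : ℝ :=
  ((Finset.univ.filter fun t => x t = a).card : ℝ) / n

/-- `ε`-typicality of a sequence w.r.t. a pmf `P`. -/
def Typical {A : Type*} (ε : ℝ) {n : ℕ} (P : A → ℝ) (x : Fin n → A) : Prop :=
  ∀ a, |freqOf x a - P a| ≤ ε * P a

section NoFB

variable {X Y1 Y2 : Type*} [Fintype X] [Fintype Y1] [Fintype Y2]

/-- Error probability of a blocklength-`n` no-feedback code over the DMBC `W`. -/
def errProbNoFB (W : X → Y1 × Y2 → ℝ) (n : ℕ) (R0 R1 R2 : ℝ)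
    (enc : Fin (msgCard n R0) × Fin (msgCard n R1) × Fin (msgCard n R2) → Fin n → X)
    (dec1 : (Fin n → Y1) → Fin (msgCard n R0) × Fin (msgCard n R1))
    (dec2 : (Fin n → Y2) → Fin (msgCard n R0) × Fin (msgCard n R2)) : ℝ :=
  (1 / ((msgCard n R0 : ℝ) * (msgCard n R1 : ℝ) * (msgCard n R2 : ℝ))) *
    ∑ m : Fin (msgCard n R0) × Fin (msgCard n R1) × Fin (msgCard n R2),
      ∑ y : Fin n → Y1 × Y2,
        (∏ t, W (enc m t) (y t)) *
          (if dec1 (fun t => (y t).1) ≠ (m.1, m.2.1) ∨ dec2 (fun t => (y t).2) ≠ (m.1, m.2.2)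
            then 1 else 0)

/-- Achievability of a rate triple over the DMBC `W` without feedback. -/
def AchievableNoFB (W : X → Y1 × Y2 → ℝ) (R0 R1 R2 : ℝ) : Prop :=
  0 ≤ R0 ∧ 0 ≤ R1 ∧ 0 ≤ R2 ∧
    ∃ enc : (n : ℕ) →
        Fin (msgCard n R0) × Fin (msgCard n R1) × Fin (msgCard n R2) → Fin n → X,
    ∃ dec1 : (n : ℕ) → (Fin n → Y1) → Fin (msgCard n R0) × Fin (msgCard n R1),
    ∃ dec2 : (n : ℕ) → (Fin n → Y2) → Fin (msgCard n R0) × Fin (msgCard n R2),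
      Filter.Tendsto (fun n => errProbNoFB W n R0 R1 R2 (enc n) (dec1 n) (dec2 n))
        Filter.atTop (nhds 0)

/-- The no-feedback capacity region. -/
def CNoFB (W : X → Y1 × Y2 → ℝ) : Set (ℝ × ℝ × ℝ) :=
  closure {r | AchievableNoFB W r.1 r.2.1 r.2.2}

end NoFB

section FB

variable {X Y1 Y2 Yt : Type*} [Fintype X] [Fintype Y1] [Fintype Y2] [Fintype Yt]

/-- Causality: the time-`t` channel input depends only on feedback symbols before time `t`. -/
def Causal {X Yt : Type*} (n : ℕ) {M : Type*} (enc : Fin n → M → (Fin n → Yt) → X) : Prop :=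
  ∀ (t : Fin n) (m : M) (fb fb' : Fin n → Yt),
    (∀ s : Fin n, (s : ℕ) < (t : ℕ) → fb s = fb' s) → enc t m fb = enc t m fb'

/-- Error probability of a blocklength-`n` feedback code over the DMBC with
generalized feedback `W`. -/
def errProbFB (W : X → Y1 × Y2 × Yt → ℝ) (n : ℕ) (R0 R1 R2 : ℝ)
    (enc : Fin n → Fin (msgCard n R0) × Fin (msgCard n R1) × Fin (msgCard n R2) →
      (Fin n → Yt) → X)
    (dec1 : (Fin n → Y1) → Fin (msgCard n R0) × Fin (msgCard n R1))
    (dec2 : (Fin n → Y2) → Fin (msgCard n R0) × Fin (msgCard n R2)) : ℝ :=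
  (1 / ((msgCard n R0 : ℝ) * (msgCard n R1 : ℝ) * (msgCard n R2 : ℝ))) *
    ∑ m : Fin (msgCard n R0) × Fin (msgCard n R1) × Fin (msgCard n R2),
      ∑ y : Fin n → Y1 × Y2 × Yt,
        (∏ t, W (enc t m fun s => (y s).2.2) (y t)) *
          (if dec1 (fun t => (y t).1) ≠ (m.1, m.2.1) ∨
              dec2 (fun t => (y t).2.1) ≠ (m.1, m.2.2)
            then 1 else 0)

/-- Achievability of a rate triple over the DMBC with generalized feedback `W`. -/
def AchievableFB (W : X → Y1 × Y2 × Yt → ℝ) (R0 R1 R2 : ℝ) : Prop :=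
  0 ≤ R0 ∧ 0 ≤ R1 ∧ 0 ≤ R2 ∧
    ∃ enc : (n : ℕ) → Fin n →
        Fin (msgCard n R0) × Fin (msgCard n R1) × Fin (msgCard n R2) → (Fin n → Yt) → X,
    ∃ dec1 : (n : ℕ) → (Fin n → Y1) → Fin (msgCard n R0) × Fin (msgCard n R1),
    ∃ dec2 : (n : ℕ) → (Fin n → Y2) → Fin (msgCard n R0) × Fin (msgCard n R2),
      (∀ n, Causal n (enc n)) ∧
      Filter.Tendsto (fun n => errProbFB W n R0 R1 R2 (enc n) (dec1 n) (dec2 n))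
        Filter.atTop (nhds 0)

/-- Capacity region of the DMBC with generalized feedback `W`. -/
def CGenFB (W : X → Y1 × Y2 × Yt → ℝ) : Set (ℝ × ℝ × ℝ) :=
  closure {r | AchievableFB W r.1 r.2.1 r.2.2}

end FB

/-- Extension of a DMBC to a generalized-feedback channel with noiseless feedback
`Ỹ = (Y₁, Y₂)`. -/
def noiselessExt {X Y1 Y2 : Type*} (W : X → Y1 × Y2 → ℝ) :
    X → Y1 × Y2 × (Y1 × Y2) → ℝ :=
  fun x y => if y.2.2 = (y.1, y.2.1) then W x (y.1, y.2.1) else 0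

/-- Capacity region of a DMBC with noiseless feedback. -/
def CNoiselessFB {X Y1 Y2 : Type*} [Fintype X] [Fintype Y1] [Fintype Y2]
    (W : X → Y1 × Y2 → ℝ) : Set (ℝ × ℝ × ℝ) :=
  CGenFB (noiselessExt W)

section Marton

variable {X Y1 Y2 : Type*} [Fintype X] [Fintype Y1] [Fintype Y2]

/-- The single-letter Marton constraints for the rate triple `(R0,R1,R2)`. -/
def MartonCond (W : X → Y1 × Y2 → ℝ) (R0 R1 R2 : ℝ) : Prop :=
  ∃ (k0 k1 k2 : ℕ) (p : Fin k0 × Fin k1 × Fin k2 → ℝ)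
    (f : Fin k0 × Fin k1 × Fin k2 → X), IsPMF p ∧
    (let w : (Fin k0 × Fin k1 × Fin k2) × Y1 × Y2 → ℝ := fun z => p z.1 * W (f z.1) z.2
     let U0 := fun z : (Fin k0 × Fin k1 × Fin k2) × Y1 × Y2 => z.1.1
     let U1 := fun z : (Fin k0 × Fin k1 × Fin k2) × Y1 × Y2 => z.1.2.1
     let U2 := fun z : (Fin k0 × Fin k1 × Fin k2) × Y1 × Y2 => z.1.2.2
     let Yr1 := fun z : (Fin k0 × Fin k1 × Fin k2) × Y1 × Y2 => z.2.1
     let Yr2 := fun z : (Fin k0 × Fin k1 × Fin k2) × Y1 × Y2 => z.2.2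
     R0 < min (miOf w U0 Yr1) (miOf w U0 Yr2) ∧
     R0 + R1 < miOf w (fun z => (U0 z, U1 z)) Yr1 ∧
     R0 + R2 < miOf w (fun z => (U0 z, U2 z)) Yr2 ∧
     R0 + R1 + R2 < cmiOf w U1 Yr1 U0 + cmiOf w U2 Yr2 U0
       + min (miOf w U0 Yr1) (miOf w U0 Yr2) - cmiOf w U1 U2 U0)

/-- Marton's achievable region for the DMBC `W` without feedback. -/
def MartonRegion (W : X → Y1 × Y2 → ℝ) : Set (ℝ × ℝ × ℝ) :=
  closure {r | 0 ≤ r.1 ∧ 0 ≤ r.2.1 ∧ 0 ≤ r.2.2 ∧ MartonCond W r.1 r.2.1 r.2.2}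

end Marton

end BCFB
namespace BCFB

/-- The generalized Dueck DMBC: input `x = (x₁, x₀, x₂)`, outputs
`y₁ = (x₁⊕z₁, x₀⊕z₀)` and `y₂ = (x₀⊕z₀, x₂⊕z₂)` where `(z₀,z₁,z₂) ~ PZ`. -/
def dueckW (PZ : Bool × Bool × Bool → ℝ) :
    Bool × Bool × Bool → (Bool × Bool) × Bool × Bool → ℝ :=
  fun x y =>
    if y.2.1 = y.1.2 then
      PZ (Bool.xor x.2.1 y.1.2, Bool.xor x.1 y.1.1, Bool.xor x.2.2 y.2.2)
    else 0

/-- The generalized Dueck DMBC with the noisy feedback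
`Ỹ = (Y₁₁⊕W₁, Y₁₀⊕W₀, Y₂₂⊕W₂)`, with feedback-noise law `Q` on `(W₀,W₁,W₂)`. -/
def dueckNoisyW (PZ : Bool × Bool × Bool → ℝ) (Q : Bool × Bool × Bool → ℝ) :
    Bool × Bool × Bool →
      (Bool × Bool) × (Bool × Bool) × (Bool × Bool × Bool) → ℝ :=
  fun x y =>
    dueckW PZ x (y.1, y.2.1) *
      Q (Bool.xor y.2.2.2.1 y.1.2, Bool.xor y.2.2.1 y.1.1, Bool.xor y.2.2.2.2 y.2.1.2)

end BCFB

namespace BCFB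

/-! ### Single-letter exponents -/

/-- A function with value `1` at `0` whose derivative there is below `-v log 2` is eventually at
most `2 ^ (-s v)` to the right of `0`. -/
lemma eventually_le_two_rpow {f : ℝ → ℝ} {d v : ℝ} (hf : HasDerivAt f d 0) (hf0 : f 0 = 1)
    (hd : d < -v * Real.log 2) :
    ∀ᶠ s in nhdsWithin (0 : ℝ) (Set.Ioi 0), f s ≤ (2 : ℝ) ^ (-(s * v)) := by
  have hg : HasDerivAt (fun s : ℝ => (2 : ℝ) ^ (-(s * v))) (-v * Real.log 2) 0 := by
    have h1 : HasDerivAt (fun s : ℝ => -(s * v)) (-v) 0 := by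
      simpa using ((hasDerivAt_id (0 : ℝ)).mul_const v).fun_neg
    have h2 := h1.const_rpow (a := 2) (by norm_num)
    convert h2 using 1
    simp
    ring
  have hsub := hf.sub hg
  rw [hasDerivAt_iff_tendsto_slope] at hsub
  have h3 : nhdsWithin (0 : ℝ) (Set.Ioi 0) ≤ nhdsWithin (0 : ℝ) {0}ᶜ :=
    nhdsWithin_mono _ fun x hx => ne_of_gt hx
  have h4 := (hsub.mono_left h3).eventually (gt_mem_nhds (by linarith : d - -v * Real.log 2 < 0))
  filter_upwards [h4, self_mem_nhdsWithin] with s hs hs0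
  have hs0 : (0 : ℝ) < s := hs0
  simp only [slope_def_field, Pi.sub_apply, hf0, sub_zero, zero_mul, neg_zero, Real.rpow_zero,
    sub_self] at hs
  rw [div_lt_iff₀ hs0] at hs
  linarith

/-- Derivative at the origin of the average of the powers `Φ z s ^ s`. -/
lemma hasDerivAt_sum_mul_rpow {Ω : Type*} [Fintype Ω] (p : Ω → ℝ) (hp : ∀ z, 0 ≤ p z)
    (Φ : Ω → ℝ → ℝ) (hc : ∀ z, 0 < p z → ContinuousAt (Φ z) 0)
    (hpos : ∀ z, 0 < p z → 0 < Φ z 0) :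
    HasDerivAt (fun s => ∑ z, p z * Φ z s ^ s) (∑ z, p z * Real.log (Φ z 0)) 0 := by
  have key : ∀ z, HasDerivAt (fun s => p z * Φ z s ^ s) (p z * Real.log (Φ z 0)) 0 := by
    intro z
    rcases (hp z).eq_or_lt with h0 | h0
    · simp only [← h0, zero_mul]
      exact hasDerivAt_const _ _
    · have hlog : ContinuousAt (fun s => Real.log (Φ z s)) 0 :=
        (hc z h0).log (hpos z h0).ne'
      have h1 : HasDerivAt (fun s => Real.log (Φ z s) * s) (Real.log (Φ z 0)) 0 := by
        rw [hasDerivAt_iff_tendsto_slope]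
        have h2 : Filter.Tendsto (fun s => Real.log (Φ z s)) (nhdsWithin 0 {0}ᶜ)
            (nhds (Real.log (Φ z 0))) := hlog.tendsto.mono_left nhdsWithin_le_nhds
        refine h2.congr' ?_
        filter_upwards [self_mem_nhdsWithin] with s hs
        have hs : s ≠ 0 := hs
        simp only [slope_def_field, mul_zero, sub_zero]
        field_simp
      have h2 := (h1.exp).const_mul (p z)
      simp only [mul_zero, Real.exp_zero, one_mul] at h2
      refine h2.congr_of_eventuallyEq ?_
      have hev : ∀ᶠ s in nhds (0 : ℝ), 0 < Φ z s := (hc z h0).eventually (lt_mem_nhds (hpos z h0))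
      filter_upwards [hev] with s hs
      rw [Real.rpow_def_of_pos hs]
  have := HasDerivAt.fun_sum (u := Finset.univ) fun z _ => key z
  exact this

/-- The exponent of the averaged powers `Φ z s ^ s` for small `s > 0`. -/
lemma eventually_sum_mul_rpow_le {Ω : Type*} [Fintype Ω] {p : Ω → ℝ} (hp : IsPMF p)
    (Φ : Ω → ℝ → ℝ) (hc : ∀ z, 0 < p z → ContinuousAt (Φ z) 0)
    (hpos : ∀ z, 0 < p z → 0 < Φ z 0) {v : ℝ} (hv : ∑ z, p z * Real.logb 2 (Φ z 0) < -v) :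
    ∀ᶠ s in nhdsWithin (0 : ℝ) (Set.Ioi 0), ∑ z, p z * Φ z s ^ s ≤ (2 : ℝ) ^ (-(s * v)) := by
  refine eventually_le_two_rpow (hasDerivAt_sum_mul_rpow p hp.1 Φ hc hpos) ?_ ?_
  · simpa using hp.2
  · have hl : 0 < Real.log 2 := Real.log_pos (by norm_num)
    have : ∑ z, p z * Real.logb 2 (Φ z 0) = (∑ z, p z * Real.log (Φ z 0)) / Real.log 2 := by
      rw [Finset.sum_div]
      exact Finset.sum_congr rfl fun z _ => by rw [Real.logb, mul_div_assoc]
    rw [this, div_lt_iff₀ hl] at hv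
    exact hv

lemma distOf_nonneg {Ω A : Type*} [Fintype Ω] {w : Ω → ℝ} (hw : ∀ ω, 0 ≤ w ω) (X : Ω → A)
    (a : A) : 0 ≤ distOf w X a :=
  Finset.sum_nonneg fun ω _ => by split_ifs <;> simp [hw ω]

lemma le_distOf {Ω A : Type*} [Fintype Ω] {w : Ω → ℝ} (hw : ∀ ω, 0 ≤ w ω) (X : Ω → A)
    (ω : Ω) : w ω ≤ distOf w X (X ω) := by
  have := Finset.single_le_sum (f := fun ω' => if X ω' = X ω then w ω' else 0)
    (fun ω' _ => by split_ifs <;> simp [hw ω']) (Finset.mem_univ ω)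
  simpa [distOf, prOf] using this

/-- Averages of functions of `X` computed through the law of `X`. -/
lemma sum_mul_comp {Ω A : Type*} [Fintype Ω] [Fintype A] (w : Ω → ℝ) (X : Ω → A) (g : A → ℝ) :
    ∑ ω, w ω * g (X ω) = ∑ a, distOf w X a * g a := by
  simp only [distOf, prOf, Finset.sum_mul, ite_mul, zero_mul]
  rw [Finset.sum_comm]
  exact Finset.sum_congr rfl fun ω _ => by simp

lemma sum_distOf {Ω A : Type*} [Fintype Ω] [Fintype A] (w : Ω → ℝ) (X : Ω → A) :
    ∑ a, distOf w X a = ∑ ω, w ω := by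
  simpa using (sum_mul_comp w X fun _ => 1).symm

/-- Entropy as an average log-loss. -/
lemma entOf_eq_neg_sum {Ω A : Type*} [Fintype Ω] [Fintype A] (w : Ω → ℝ) (X : Ω → A) :
    entOf w X = -∑ ω, w ω * Real.logb 2 (distOf w X (X ω)) := by
  rw [entOf, sum_mul_comp w X fun a => Real.logb 2 (distOf w X a)]

lemma distOf_id {Ω : Type*} [Fintype Ω] (w : Ω → ℝ) (a : Ω) :
    distOf w (fun ω => ω) a = w a := by
  simp [distOf, prOf]

/-! ### Sums along a causal recursion -/

/-- If each factor of a causal product has conditional sum at most `c t`, the whole sum is at most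
the product of the `c t`. -/
lemma sum_prod_causal_le {V : Type*} [Fintype V] [Nonempty V] :
    ∀ {n : ℕ} (g : Fin n → (Fin n → V) → ℝ) (c : Fin n → ℝ),
      (∀ t v, 0 ≤ g t v) →
      (∀ t v v', (∀ s, s ≤ t → v s = v' s) → g t v = g t v') →
      (∀ t v, ∑ a, g t (Function.update v t a) ≤ c t) →
      ∑ v, ∏ t, g t v ≤ ∏ t, c t := by
  intro n
  induction n with
  | zero => intro g c _ _ _; simp
  | succ n ih =>
    intro g c h0 hc hs
    obtain ⟨a0⟩ := ‹Nonempty V›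
    have hc' : ∀ (t : Fin n) (v : Fin n → V) (a b : V),
        g t.castSucc (Fin.snoc v a : Fin (n + 1) → V) = g t.castSucc (Fin.snoc v b) := by
      intro t v a b
      refine hc _ _ _ fun s hs' => ?_
      have : s ≠ Fin.last n := fun h => by
        rw [h] at hs'
        exact absurd hs' (not_le.2 (Fin.castSucc_lt_last t))
      obtain ⟨s, rfl⟩ := Fin.exists_castSucc_eq.2 this
      simp
    have hlast : ∀ v : Fin n → V, ∑ a, g (Fin.last n) (Fin.snoc v a : Fin (n + 1) → V)
        ≤ c (Fin.last n) := by
      intro v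
      have := hs (Fin.last n) (Fin.snoc v a0)
      simpa [Fin.update_snoc_last] using this
    have hcn : 0 ≤ c (Fin.last n) :=
      (Finset.sum_nonneg fun a _ => h0 _ _).trans (hlast fun _ => a0)
    rw [← (Fin.snocEquiv fun _ => V).sum_comp, Fintype.sum_prod_type_right]
    calc ∑ v : Fin n → V, ∑ a, ∏ t, g t ((Fin.snocEquiv fun _ => V) (a, v))
        = ∑ v : Fin n → V, (∏ t : Fin n, g t.castSucc (Fin.snoc v a0 : Fin (n + 1) → V)) *
            ∑ a, g (Fin.last n) (Fin.snoc v a : Fin (n + 1) → V) := by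
          refine Finset.sum_congr rfl fun v _ => ?_
          rw [Finset.mul_sum]
          refine Finset.sum_congr rfl fun a _ => ?_
          rw [Fin.prod_univ_castSucc]
          congr 1
          exact Finset.prod_congr rfl fun t _ => hc' t v a a0
      _ ≤ ∑ v : Fin n → V, (∏ t : Fin n, g t.castSucc (Fin.snoc v a0 : Fin (n + 1) → V)) *
            c (Fin.last n) := by
          gcongr with v
          · exact Finset.prod_nonneg fun t _ => h0 _ _
          · exact hlast v
      _ ≤ (∏ t : Fin n, c t.castSucc) * c (Fin.last n) := by
          rw [← Finset.sum_mul]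
          refine mul_le_mul_of_nonneg_right (ih _ _ (fun t v => h0 _ _) ?_ ?_) hcn
          · intro t v v' h
            refine hc _ _ _ fun s hs' => ?_
            induction s using Fin.lastCases with
            | last => simp
            | cast s => simpa using h s (by simpa using hs')
          · intro t v
            simpa using hs t.castSucc (Fin.snoc v a0)
      _ = ∏ t, c t := (Fin.prod_univ_castSucc c).symm

/-- If each factor of a causal product has conditional sum `1`, so has the product. -/
lemma sum_prod_causal_eq_one {V : Type*} [Fintype V] [Nonempty V] :
    ∀ {n : ℕ} (g : Fin n → (Fin n → V) → ℝ),
      (∀ t v v', (∀ s, s ≤ t → v s = v' s) → g t v = g t v') →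
      (∀ t v, ∑ a, g t (Function.update v t a) = 1) →
      ∑ v, ∏ t, g t v = 1 := by
  intro n
  induction n with
  | zero => intro g _ _; simp
  | succ n ih =>
    intro g hc hs
    obtain ⟨a0⟩ := ‹Nonempty V›
    have hc' : ∀ (t : Fin n) (v : Fin n → V) (a b : V),
        g t.castSucc (Fin.snoc v a : Fin (n + 1) → V) = g t.castSucc (Fin.snoc v b) := by
      intro t v a b
      refine hc _ _ _ fun s hs' => ?_
      have : s ≠ Fin.last n := fun h => by
        rw [h] at hs'
        exact absurd hs' (not_le.2 (Fin.castSucc_lt_last t))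
      obtain ⟨s, rfl⟩ := Fin.exists_castSucc_eq.2 this
      simp
    have hlast : ∀ v : Fin n → V, ∑ a, g (Fin.last n) (Fin.snoc v a : Fin (n + 1) → V) = 1 := by
      intro v
      have := hs (Fin.last n) (Fin.snoc v a0)
      simpa [Fin.update_snoc_last] using this
    rw [← (Fin.snocEquiv fun _ => V).sum_comp, Fintype.sum_prod_type_right]
    rw [← ih (fun t v => g t.castSucc (Fin.snoc v a0 : Fin (n + 1) → V)) ?_ ?_]
    · refine Finset.sum_congr rfl fun v _ => ?_
      rw [← mul_one (∏ t : Fin n, _), ← hlast v, Finset.mul_sum]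
      refine Finset.sum_congr rfl fun a _ => ?_
      rw [Fin.prod_univ_castSucc]
      congr 1
      exact Finset.prod_congr rfl fun t _ => hc' t v a a0
    · intro t v v' h
      refine hc _ _ _ fun s hs' => ?_
      induction s using Fin.lastCases with
      | last => simp
      | cast s => simpa using h s (by simpa using hs')
    · intro t v
      simpa using hs t.castSucc (Fin.snoc v a0)

/-! ### The channel in terms of its three distinct output bits -/

/-- The noise `(z₀, z₁, z₂)` turning the input `x = (x₁, x₀, x₂)` into the output bits
`v = (y₀, y₁, y₂)`. -/
def noiseOf (x v : Bool × Bool × Bool) : Bool × Bool × Bool :=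
  (Bool.xor x.2.1 v.1, Bool.xor x.1 v.2.1, Bool.xor x.2.2 v.2.2)

/-- The pair of channel outputs formed by the three distinct output bits. -/
def outPair (v : Bool × Bool × Bool) : (Bool × Bool) × Bool × Bool :=
  ((v.2.1, v.1), (v.1, v.2.2))

/-- For a fixed output, the noise bits and the output bits determine each other. -/
def noiseEquiv (x : Bool × Bool × Bool) : Bool × Bool × Bool ≃ Bool × Bool × Bool where
  toFun := noiseOf x
  invFun := noiseOf x
  left_inv v := by simp [noiseOf]
  right_inv v := by simp [noiseOf]

lemma sum_noiseOf (f : Bool × Bool × Bool → ℝ) (x : Bool × Bool × Bool) :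
    ∑ v, f (noiseOf x v) = ∑ z, f z :=
  (noiseEquiv x).sum_comp f

lemma errProbFB_dueck (PZ : Bool × Bool × Bool → ℝ) (n : ℕ) (R0 R1 R2 : ℝ)
    (enc : Fin n → Fin (msgCard n R0) × Fin (msgCard n R1) × Fin (msgCard n R2) →
      (Fin n → (Bool × Bool) × Bool × Bool) → Bool × Bool × Bool)
    (dec1 : (Fin n → Bool × Bool) → Fin (msgCard n R0) × Fin (msgCard n R1))
    (dec2 : (Fin n → Bool × Bool) → Fin (msgCard n R0) × Fin (msgCard n R2)) :
    errProbFB (noiselessExt (dueckW PZ)) n R0 R1 R2 enc dec1 dec2 =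
      (1 / ((msgCard n R0 : ℝ) * (msgCard n R1 : ℝ) * (msgCard n R2 : ℝ))) *
        ∑ m : Fin (msgCard n R0) × Fin (msgCard n R1) × Fin (msgCard n R2),
          ∑ v : Fin n → Bool × Bool × Bool,
            (∏ t, PZ (noiseOf (enc t m fun s => outPair (v s)) (v t))) *
              (if dec1 (fun t => ((v t).2.1, (v t).1)) ≠ (m.1, m.2.1) ∨
                  dec2 (fun t => ((v t).1, (v t).2.2)) ≠ (m.1, m.2.2) then 1 else 0) := by
  unfold errProbFB
  congr 1
  refine Finset.sum_congr rfl fun m _ => Eq.symm ?_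
  refine Fintype.sum_of_injective
    (fun (v : Fin n → Bool × Bool × Bool) t =>
      ((outPair (v t)).1, (outPair (v t)).2, outPair (v t))) ?_ _ _ ?_ ?_
  · intro v v' h
    funext t
    have := congrFun h t
    simp only [outPair, Prod.mk.injEq] at this
    ext <;> simp [this]
  · intro y hy
    have : ∃ t, noiselessExt (dueckW PZ) (enc t m fun s => (y s).2.2) (y t) = 0 := by
      by_contra hcon
      push Not at hcon
      refine hy ⟨fun t => ((y t).1.2, (y t).1.1, (y t).2.1.2), funext fun t => ?_⟩
      have ht := hcon t
      unfold noiselessExt dueckW at ht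
      split_ifs at ht with h1 h2
      · simp only at h2
        ext <;> simp [outPair, h1, h2]
      · exact absurd rfl ht
      · exact absurd rfl ht
    obtain ⟨t, ht⟩ := this
    rw [Finset.prod_eq_zero (Finset.mem_univ t) ht, zero_mul]
  · intro v
    simp only [noiselessExt, dueckW, outPair, noiseOf, if_true]
    congr

/-! ### Converse -/

/-- Success probability bound for a feedback code observed through `φ`, whose observation kernel
`Q` has a small moment of order `1 + s`. -/
lemma success_le {X V A M : Type*} [Fintype V] [Nonempty V] [Fintype A] [Fintype M] {n : ℕ}
    (K : X → V → ℝ) (hK : ∀ x v, 0 ≤ K x v) (φ : V → A) (Q : X → A → ℝ)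
    (hQ : ∀ x a, ∑ v, (if φ v = a then K x v else 0) = Q x a) {s c τ : ℝ} (hs : 0 < s)
    (hτ : 0 < τ) (hc : ∀ x, ∑ v, K x v * Q x (φ v) ^ s ≤ c)
    (x : M → Fin n → (Fin n → V) → X)
    (hx : ∀ m t v v', (∀ i : Fin n, i < t → v i = v' i) → x m t v = x m t v')
    (D : (Fin n → A) → M) :
    ∑ m, ∑ v : Fin n → V,
        (∏ t, K (x m t v) (v t)) * (if D (fun t => φ (v t)) = m then 1 else 0) ≤
      Fintype.card M * (c ^ n * (τ ^ s)⁻¹) + τ * (Fintype.card A : ℝ) ^ n := by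
  have hQ0 : ∀ x a, 0 ≤ Q x a := fun x a => by
    rw [← hQ]
    exact Finset.sum_nonneg fun v _ => by split_ifs <;> simp [hK]
  have hKQ : ∀ x v, K x v ≤ Q x (φ v) := fun x v => by
    rw [← hQ]
    have := Finset.single_le_sum (f := fun v' => if φ v' = φ v then K x v' else 0)
      (fun v' _ => by split_ifs <;> simp [hK]) (Finset.mem_univ v)
    simpa using this
  have hupd : ∀ m t (v : Fin n → V) a, x m t (Function.update v t a) = x m t v :=
    fun m t v a => hx m t _ _ fun i hi => Function.update_of_ne hi.ne _ _
  have hcausal : ∀ (f : Fin n → X → V → ℝ) m t (v v' : Fin n → V),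
      (∀ i, i ≤ t → v i = v' i) → f t (x m t v) (v t) = f t (x m t v') (v' t) :=
    fun f m t v v' h => by rw [hx m t v v' fun i hi => h i hi.le, h t le_rfl]
  have hpt : ∀ m (v : Fin n → V),
      (∏ t, K (x m t v) (v t)) * (if D (fun t => φ (v t)) = m then 1 else 0) ≤
        (∏ t, K (x m t v) (v t) * Q (x m t v) (φ (v t)) ^ s) * (τ ^ s)⁻¹ +
        ∑ a : Fin n → A, (if D a = m then 1 else 0) *
          (τ * ∏ t, (if φ (v t) = a t then K (x m t v) (v t) / Q (x m t v) (a t) else 0)) := by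
    intro m v
    have hP : 0 ≤ ∏ t, K (x m t v) (v t) := Finset.prod_nonneg fun t _ => hK _ _
    have hPQ : 0 ≤ ∏ t, Q (x m t v) (φ (v t)) := Finset.prod_nonneg fun t _ => hQ0 _ _
    have hterm : ∀ a : Fin n → A, 0 ≤ (if D a = m then (1 : ℝ) else 0) *
          (τ * ∏ t, (if φ (v t) = a t then K (x m t v) (v t) / Q (x m t v) (a t) else 0)) := by
      intro a
      refine mul_nonneg (by split_ifs <;> simp) (mul_nonneg hτ.le
        (Finset.prod_nonneg fun t _ => ?_))
      split_ifs
      · exact div_nonneg (hK _ _) (hQ0 _ _)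
      · exact le_rfl
    have hfirst : (∏ t, K (x m t v) (v t) * Q (x m t v) (φ (v t)) ^ s) * (τ ^ s)⁻¹ =
        (∏ t, K (x m t v) (v t)) * (((∏ t, Q (x m t v) (φ (v t))) / τ) ^ s) := by
      rw [Finset.prod_mul_distrib, Real.finsetProd_rpow _ _ (fun t _ => hQ0 _ _),
        Real.div_rpow hPQ hτ.le]
      ring
    rw [hfirst]
    by_cases hbig : τ < ∏ t, Q (x m t v) (φ (v t))
    · refine le_add_of_le_of_nonneg ?_ (Finset.sum_nonneg fun a _ => hterm a)
      refine mul_le_mul_of_nonneg_left ?_ hP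
      have : (1 : ℝ) ≤ ((∏ t, Q (x m t v) (φ (v t))) / τ) ^ s :=
        Real.one_le_rpow (by rw [le_div_iff₀ hτ]; linarith) hs.le
      refine le_trans ?_ this
      split_ifs <;> norm_num
    · push Not at hbig
      refine le_add_of_nonneg_of_le
        (mul_nonneg hP (Real.rpow_nonneg (div_nonneg hPQ hτ.le) _)) ?_
      refine le_trans ?_ (Finset.single_le_sum (fun a _ => hterm a)
        (Finset.mem_univ fun t => φ (v t)))
      rw [mul_comm]
      refine mul_le_mul_of_nonneg_left ?_ (by split_ifs <;> simp)
      simp only [if_true]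
      have : ∏ t, K (x m t v) (v t) = (∏ t, Q (x m t v) (φ (v t))) *
          ∏ t, (K (x m t v) (v t) / Q (x m t v) (φ (v t))) := by
        rw [← Finset.prod_mul_distrib]
        refine Finset.prod_congr rfl fun t _ => ?_
        rcases (hQ0 (x m t v) (φ (v t))).eq_or_lt with h | h
        · rw [← h, zero_mul]
          exact le_antisymm (by rw [h]; exact hKQ _ _) (hK _ _)
        · field_simp
      rw [this]
      exact mul_le_mul_of_nonneg_right hbig
        (Finset.prod_nonneg fun t _ => div_nonneg (hK _ _) (hQ0 _ _))
  have h1 : ∀ m, ∑ v : Fin n → V, ∏ t, K (x m t v) (v t) * Q (x m t v) (φ (v t)) ^ s ≤ c ^ n := by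
    intro m
    have := sum_prod_causal_le (V := V)
      (fun t v => K (x m t v) (v t) * Q (x m t v) (φ (v t)) ^ s) (fun _ => c)
      (fun t v => mul_nonneg (hK _ _) (Real.rpow_nonneg (hQ0 _ _) _))
      (hcausal (fun _ x v => K x v * Q x (φ v) ^ s) m)
      (fun t v => by
        simp only [hupd, Function.update_self]
        exact hc _)
    simpa using this
  have h2 : ∀ m (a : Fin n → A), ∑ v : Fin n → V,
      ∏ t, (if φ (v t) = a t then K (x m t v) (v t) / Q (x m t v) (a t) else 0) ≤ 1 := by
    intro m a
    have := sum_prod_causal_le (V := V)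
      (fun t v => if φ (v t) = a t then K (x m t v) (v t) / Q (x m t v) (a t) else 0)
      (fun _ => 1)
      (fun t v => by
        split_ifs
        · exact div_nonneg (hK _ _) (hQ0 _ _)
        · exact le_rfl)
      (hcausal (fun t x v => if φ v = a t then K x v / Q x (a t) else 0) m)
      (fun t v => by
        simp only [hupd, Function.update_self]
        have : ∀ w, (if φ w = a t then K (x m t v) w / Q (x m t v) (a t) else 0) =
            (if φ w = a t then K (x m t v) w else 0) / Q (x m t v) (a t) := fun w => by
          split_ifs <;> simp
        simp only [this]
        rw [← Finset.sum_div, hQ]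
        exact div_self_le_one _)
    simpa using this
  calc _ ≤ ∑ m, ∑ v : Fin n → V,
        ((∏ t, K (x m t v) (v t) * Q (x m t v) (φ (v t)) ^ s) * (τ ^ s)⁻¹ +
        ∑ a : Fin n → A, (if D a = m then 1 else 0) *
          (τ * ∏ t, (if φ (v t) = a t then K (x m t v) (v t) / Q (x m t v) (a t) else 0))) :=
        Finset.sum_le_sum fun m _ => Finset.sum_le_sum fun v _ => hpt m v
    _ = ∑ m, ((∑ v : Fin n → V, ∏ t, K (x m t v) (v t) * Q (x m t v) (φ (v t)) ^ s) *
          (τ ^ s)⁻¹ + ∑ a : Fin n → A, (if D a = m then 1 else 0) * (τ * ∑ v : Fin n → V,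
            ∏ t, (if φ (v t) = a t then K (x m t v) (v t) / Q (x m t v) (a t) else 0))) := by
        refine Finset.sum_congr rfl fun m _ => ?_
        rw [Finset.sum_add_distrib, Finset.sum_mul, Finset.sum_comm]
        simp only [Finset.mul_sum]
    _ ≤ ∑ m : M, (c ^ n * (τ ^ s)⁻¹ +
          ∑ a : Fin n → A, (if D a = m then (1 : ℝ) else 0) * (τ * 1)) := by
        gcongr with m _ a _
        · exact h1 m
        · exact h2 m a
    _ = Fintype.card M * (c ^ n * (τ ^ s)⁻¹) + τ * (Fintype.card A : ℝ) ^ n := by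
        rw [Finset.sum_add_distrib, Finset.sum_comm]
        simp [Finset.sum_ite_eq, mul_comm]

/-- The law of the observation `φ` of the output is the law of `φ` of the noise, shifted. -/
lemma sum_fiber_noiseOf {A : Type*} (PZ : Bool × Bool × Bool → ℝ) {φ : Bool × Bool × Bool → A}
    (hφ : ∀ x z v, φ (noiseOf x z) = φ v ↔ φ z = φ (noiseOf x v)) (x v : Bool × Bool × Bool) :
    ∑ w, (if φ w = φ v then PZ (noiseOf x w) else 0) = distOf PZ φ (φ (noiseOf x v)) := by
  have h2 : ∀ z, noiseOf x (noiseOf x z) = z := (noiseEquiv x).left_inv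
  refine (Equiv.sum_comp (noiseEquiv x)
    (fun w => if φ w = φ v then PZ (noiseOf x w) else (0 : ℝ))).symm.trans ?_
  simp only [noiseEquiv, Equiv.coe_fn_mk, h2, hφ]
  rfl

lemma one_sub_err_le {PZ : Bool × Bool × Bool → ℝ} (hPZ : IsPMF PZ) {A B M T : Type*}
    [Fintype A] [Fintype B] [Fintype M] [Fintype T] [Nonempty T] (e : B × M ≃ T)
    {φ : Bool × Bool × Bool → A}
    (hφ : ∀ x z v, φ (noiseOf x z) = φ v ↔ φ z = φ (noiseOf x v)) {n : ℕ}
    (x : T → Fin n → (Fin n → Bool × Bool × Bool) → Bool × Bool × Bool)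
    (hx : ∀ m t v v', (∀ i : Fin n, i < t → v i = v' i) → x m t v = x m t v')
    (err : T → (Fin n → Bool × Bool × Bool) → Prop) [∀ m v, Decidable (err m v)] (D : (Fin n → A) → M)
    (hD : ∀ b m v, ¬ err (e (b, m)) v → D (fun t => φ (v t)) = m) {s c τ : ℝ} (hs : 0 < s)
    (hτ : 0 < τ) (hc : ∑ z, PZ z * distOf PZ φ (φ z) ^ s ≤ c) :
    1 - 1 / (Fintype.card T : ℝ) * ∑ m, ∑ v : Fin n → Bool × Bool × Bool,
        (∏ t, PZ (noiseOf (x m t v) (v t))) * (if err m v then 1 else 0) ≤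
      c ^ n * (τ ^ s)⁻¹ + τ * (Fintype.card A : ℝ) ^ n / Fintype.card M := by
  have hTpos : (0 : ℝ) < Fintype.card T := by exact_mod_cast Fintype.card_pos
  have hcard : (Fintype.card B : ℝ) * Fintype.card M = Fintype.card T := by
    rw [← Fintype.card_congr e, Fintype.card_prod]
    push_cast
    rfl
  have hMpos : (0 : ℝ) < Fintype.card M := by
    rcases (Nat.cast_nonneg (α := ℝ) (Fintype.card M)).eq_or_lt with h | h
    · rw [← h, mul_zero] at hcard
      exact absurd hcard hTpos.ne
    · exact h
  have hone : ∀ m, ∑ v : Fin n → Bool × Bool × Bool, ∏ t, PZ (noiseOf (x m t v) (v t)) = 1 := by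
    intro m
    refine sum_prod_causal_eq_one _ (fun t v v' h => ?_) fun t v => ?_
    · rw [hx m t v v' fun i hi => h i hi.le, h t le_rfl]
    · have : ∀ a, x m t (Function.update v t a) = x m t v := fun a =>
        hx m t _ _ fun i hi => Function.update_of_ne hi.ne _ _
      simp only [this, Function.update_self]
      rw [sum_noiseOf, hPZ.2]
  have hsucc : 1 - 1 / (Fintype.card T : ℝ) * ∑ m, ∑ v : Fin n → Bool × Bool × Bool,
        (∏ t, PZ (noiseOf (x m t v) (v t))) * (if err m v then 1 else 0) =
      1 / (Fintype.card T : ℝ) * ∑ m, ∑ v : Fin n → Bool × Bool × Bool,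
        (∏ t, PZ (noiseOf (x m t v) (v t))) * (if ¬ err m v then 1 else 0) := by
    have h1 : 1 / (Fintype.card T : ℝ) * ∑ m : T, ∑ v : Fin n → Bool × Bool × Bool,
        ∏ t, PZ (noiseOf (x m t v) (v t)) = 1 := by
      simp only [hone]
      simp [hTpos.ne']
    rw [sub_eq_iff_eq_add, ← mul_add, ← Finset.sum_add_distrib]
    refine h1.symm.trans ?_
    congr 1
    refine Finset.sum_congr rfl fun m _ => ?_
    rw [← Finset.sum_add_distrib]
    refine Finset.sum_congr rfl fun v _ => ?_
    split_ifs <;> simp_all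
  have hb : ∀ b : B, ∑ m : M, ∑ v : Fin n → Bool × Bool × Bool,
      (∏ t, PZ (noiseOf (x (e (b, m)) t v) (v t))) * (if ¬ err (e (b, m)) v then 1 else 0) ≤
      Fintype.card M * (c ^ n * (τ ^ s)⁻¹) + τ * (Fintype.card A : ℝ) ^ n := by
    intro b
    refine le_trans ?_ (success_le (fun x v => PZ (noiseOf x v)) (fun x v => hPZ.1 _) φ
      (fun x a => ∑ w, if φ w = a then PZ (noiseOf x w) else 0) (fun _ _ => rfl) hs hτ ?_
      (fun m => x (e (b, m))) (fun m => hx _) D)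
    · refine Finset.sum_le_sum fun m _ => Finset.sum_le_sum fun v _ => ?_
      refine mul_le_mul_of_nonneg_left ?_ (Finset.prod_nonneg fun t _ => hPZ.1 _)
      by_cases h : err (e (b, m)) v
      · simp only [h, not_true_eq_false, if_false]
        split_ifs <;> norm_num
      · simp [h, hD b m v h]
    · intro x
      simp only [sum_fiber_noiseOf PZ hφ]
      rw [sum_noiseOf (fun z => PZ z * distOf PZ φ (φ z) ^ s) x]
      exact hc
  rw [hsucc, ← e.sum_comp, Fintype.sum_prod_type]
  calc _ ≤ 1 / (Fintype.card T : ℝ) * ∑ _b : B,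
        (Fintype.card M * (c ^ n * (τ ^ s)⁻¹) + τ * (Fintype.card A : ℝ) ^ n) := by
        gcongr with b
        exact hb b
    _ = c ^ n * (τ ^ s)⁻¹ + τ * (Fintype.card A : ℝ) ^ n / Fintype.card M := by
        rw [Finset.sum_const, Finset.card_univ, nsmul_eq_mul, ← hcard]
        have hB : (Fintype.card B : ℝ) ≠ 0 := fun h => by
          rw [h, zero_mul] at hcard
          exact hTpos.ne hcard
        field_simp

lemma tendsto_two_rpow_neg_mul {a : ℝ} (ha : 0 < a) :
    Filter.Tendsto (fun n : ℕ => (2 : ℝ) ^ (-(n * a))) Filter.atTop (nhds 0) := by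
  have h : ∀ n : ℕ, (2 : ℝ) ^ (-(n * a)) = ((2 : ℝ) ^ (-a)) ^ n := fun n => by
    rw [← Real.rpow_natCast, ← Real.rpow_mul (by norm_num)]
    ring_nf
  simp only [h]
  exact tendsto_pow_atTop_nhds_zero_of_lt_one (by positivity)
    (Real.rpow_lt_one_of_one_lt_of_neg (by norm_num) (by linarith))

/-- Asymptotic form of the converse. -/
lemma rate_le {PZ : Bool × Bool × Bool → ℝ} (hPZ : IsPMF PZ) {A : Type*} [Fintype A]
    (φ : Bool × Bool × Bool → A) {R L : ℝ} (hL : (Fintype.card A : ℝ) = (2 : ℝ) ^ L)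
    {S M : ℕ → ℝ} (hM : ∀ n : ℕ, (2 : ℝ) ^ (n * R) ≤ 4 * M n)
    (hS : Filter.Tendsto S Filter.atTop (nhds 1))
    (h : ∀ (n : ℕ) (s c τ : ℝ), 0 < s → 0 < τ → ∑ z, PZ z * distOf PZ φ (φ z) ^ s ≤ c →
      S n ≤ c ^ n * (τ ^ s)⁻¹ + τ * (Fintype.card A : ℝ) ^ n / M n) :
    R ≤ L - entOf PZ φ := by
  by_contra hcon
  push Not at hcon
  obtain ⟨v, hv1, hv2⟩ := exists_between (show L - R < entOf PZ φ by linarith)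
  obtain ⟨w, hw1, hw2⟩ := exists_between hv2
  have hpos : ∀ z, 0 < PZ z → 0 < distOf PZ φ (φ z) := fun z hz =>
    hz.trans_le (le_distOf hPZ.1 φ z)
  have hev := eventually_sum_mul_rpow_le hPZ (fun z _ => distOf PZ φ (φ z))
    (fun z _ => continuousAt_const) hpos (v := w) (by
      rw [entOf_eq_neg_sum] at hw2
      linarith)
  obtain ⟨s, hs, hs0⟩ := (hev.and self_mem_nhdsWithin).exists
  have hs0 : 0 < s := hs0
  have hlim : Filter.Tendsto (fun n : ℕ => (2 : ℝ) ^ (-(n * (s * (w - v)))) +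
      4 * (2 : ℝ) ^ (-(n * (v + R - L)))) Filter.atTop (nhds (0 + 4 * 0)) :=
    (tendsto_two_rpow_neg_mul (mul_pos hs0 (by linarith))).add
      ((tendsto_two_rpow_neg_mul (by linarith)).const_mul 4)
  have hle := le_of_tendsto_of_tendsto' hS hlim fun n => by
    refine (h n s _ ((2 : ℝ) ^ (-(n * v))) hs0 (by positivity) hs).trans ?_
    refine add_le_add (le_of_eq ?_) ?_
    · rw [← Real.rpow_natCast, ← Real.rpow_mul (by norm_num), ← Real.rpow_mul (by norm_num),
        ← Real.rpow_neg (by norm_num), ← Real.rpow_add (by norm_num)]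
      ring_nf
    · have hMn : 0 < M n := by
        have := (Real.rpow_pos_of_pos (by norm_num : (0 : ℝ) < 2) (n * R)).trans_le (hM n)
        linarith
      rw [div_le_iff₀ hMn, hL, ← Real.rpow_natCast, ← Real.rpow_mul (by norm_num),
        ← Real.rpow_add (by norm_num)]
      calc (2 : ℝ) ^ (-(n * v) + L * n)
          = (2 : ℝ) ^ (-(n * (v + R - L))) * (2 : ℝ) ^ (n * R) := by
            rw [← Real.rpow_add (by norm_num)]
            ring_nf
        _ ≤ (2 : ℝ) ^ (-(n * (v + R - L))) * (4 * M n) := by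
            gcongr
            exact hM n
        _ = 4 * (2 : ℝ) ^ (-(n * (v + R - L))) * M n := by ring
  norm_num at hle

lemma two_rpow_le_two_mul_msgCard (n : ℕ) {R : ℝ} (hR : 0 ≤ R) :
    (2 : ℝ) ^ (n * R) ≤ 2 * msgCard n R := by
  have h1 : (1 : ℝ) ≤ (2 : ℝ) ^ (n * R) := Real.one_le_rpow (by norm_num) (by positivity)
  have h2 : (2 : ℝ) ^ (n * R) < msgCard n R + 1 := Nat.lt_floor_add_one _
  have h3 : (1 : ℝ) ≤ msgCard n R := by
    have : 1 ≤ msgCard n R := Nat.le_floor (by simpa using h1)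
    exact_mod_cast this
  linarith

lemma msgCard_pos (n : ℕ) {R : ℝ} (hR : 0 ≤ R) : 0 < msgCard n R := by
  have := two_rpow_le_two_mul_msgCard n hR
  have h1 : (0 : ℝ) < (2 : ℝ) ^ (n * R) := by positivity
  have : (0 : ℝ) < msgCard n R := by linarith
  exact_mod_cast this

/-- Outer bound for every achievable triple. -/
lemma AchievableFB.rates_le {PZ : Bool × Bool × Bool → ℝ} (hPZ : IsPMF PZ) {R0 R1 R2 : ℝ}
    (h : AchievableFB (noiselessExt (dueckW PZ)) R0 R1 R2) :
    R1 ≤ 2 - entOf PZ (fun z => (z.1, z.2.1)) ∧ R2 ≤ 2 - entOf PZ (fun z => (z.1, z.2.2)) ∧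
      R1 + R2 ≤ 3 - entOf PZ (fun z => z) := by
  obtain ⟨h0, h1, h2, enc, dec1, dec2, hcausal, hlim⟩ := h
  have hS : Filter.Tendsto (fun n => 1 - errProbFB (noiselessExt (dueckW PZ)) n R0 R1 R2 (enc n)
      (dec1 n) (dec2 n)) Filter.atTop (nhds 1) := by
    simpa using hlim.const_sub 1
  have hx : ∀ n (m : Fin (msgCard n R0) × Fin (msgCard n R1) × Fin (msgCard n R2)) (t : Fin n)
      (v v' : Fin n → Bool × Bool × Bool), (∀ i : Fin n, i < t → v i = v' i) →
      enc n t m (fun s => outPair (v s)) = enc n t m (fun s => outPair (v' s)) :=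
    fun n m t v v' hv => hcausal n t m _ _ fun s hs => by rw [hv s hs]
  have hne : ∀ n, Nonempty (Fin (msgCard n R0) × Fin (msgCard n R1) × Fin (msgCard n R2)) :=
    fun n => ⟨⟨0, msgCard_pos n h0⟩, ⟨0, msgCard_pos n h1⟩, ⟨0, msgCard_pos n h2⟩⟩
  have herr : ∀ n, errProbFB (noiselessExt (dueckW PZ)) n R0 R1 R2 (enc n) (dec1 n) (dec2 n) =
      1 / (Fintype.card (Fin (msgCard n R0) × Fin (msgCard n R1) × Fin (msgCard n R2)) : ℝ) *
        ∑ m, ∑ v : Fin n → Bool × Bool × Bool,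
            (∏ t, PZ (noiseOf (enc n t m fun s => outPair (v s)) (v t))) *
              (if dec1 n (fun t => ((v t).2.1, (v t).1)) ≠ (m.1, m.2.1) ∨
                  dec2 n (fun t => ((v t).1, (v t).2.2)) ≠ (m.1, m.2.2) then 1 else 0) := by
    intro n
    rw [errProbFB_dueck]
    simp only [Fintype.card_prod, Fintype.card_fin, Nat.cast_mul, mul_assoc]
  refine ⟨?_, ?_, ?_⟩
  · refine rate_le hPZ (fun z => (z.1, z.2.1)) (M := fun n => (msgCard n R1 : ℝ)) ?_ ?_ hS ?_
    · norm_num [Fintype.card_prod]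
    · intro n
      have := two_rpow_le_two_mul_msgCard n h1
      have : (0 : ℝ) ≤ msgCard n R1 := Nat.cast_nonneg _
      linarith
    · intro n s c τ hs hτ hc
      have := hne n
      rw [herr]
      have := one_sub_err_le hPZ
        (⟨fun p => (p.1.1, p.2, p.1.2), fun q => ((q.1, q.2.2), q.2.1), fun _ => rfl,
          fun _ => rfl⟩ : (Fin (msgCard n R0) × Fin (msgCard n R2)) × Fin (msgCard n R1) ≃ _)
        (φ := fun z => (z.1, z.2.1)) (by decide) _ (hx n)
        (fun m v => dec1 n (fun t => ((v t).2.1, (v t).1)) ≠ (m.1, m.2.1) ∨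
                  dec2 n (fun t => ((v t).1, (v t).2.2)) ≠ (m.1, m.2.2))
        (fun a => (dec1 n fun t => ((a t).2, (a t).1)).2) (fun b m v hb => by
          push Not at hb
          have := hb.1
          simp only [Equiv.coe_fn_mk] at this
          simp [this]) hs hτ hc
      simpa only [Fintype.card_fin] using this
  · refine rate_le hPZ (fun z => (z.1, z.2.2)) (M := fun n => (msgCard n R2 : ℝ)) ?_ ?_ hS ?_
    · norm_num [Fintype.card_prod]
    · intro n
      have := two_rpow_le_two_mul_msgCard n h2
      have : (0 : ℝ) ≤ msgCard n R2 := Nat.cast_nonneg _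
      linarith
    · intro n s c τ hs hτ hc
      have := hne n
      rw [herr]
      have := one_sub_err_le hPZ
        (⟨fun p => (p.1.1, p.1.2, p.2), fun q => ((q.1, q.2.1), q.2.2), fun _ => rfl,
          fun _ => rfl⟩ : (Fin (msgCard n R0) × Fin (msgCard n R1)) × Fin (msgCard n R2) ≃ _)
        (φ := fun z => (z.1, z.2.2)) (by decide) _ (hx n)
        (fun m v => dec1 n (fun t => ((v t).2.1, (v t).1)) ≠ (m.1, m.2.1) ∨
                  dec2 n (fun t => ((v t).1, (v t).2.2)) ≠ (m.1, m.2.2))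
        (fun a => (dec2 n a).2) (fun b m v hb => by
          push Not at hb
          have := hb.2
          simp only [Equiv.coe_fn_mk] at this
          simp [this]) hs hτ hc
      simpa only [Fintype.card_fin] using this
  · refine rate_le hPZ (fun z => z) (M := fun n => (msgCard n R1 : ℝ) * msgCard n R2) ?_ ?_ hS ?_
    · norm_num [Fintype.card_prod]
    · intro n
      rw [mul_add, Real.rpow_add (by norm_num)]
      have := mul_le_mul (two_rpow_le_two_mul_msgCard n h1) (two_rpow_le_two_mul_msgCard n h2)
        (by positivity) (by positivity)
      linarith
    · intro n s c τ hs hτ hc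
      have := hne n
      rw [herr]
      have := one_sub_err_le hPZ
        (Equiv.refl (Fin (msgCard n R0) × Fin (msgCard n R1) × Fin (msgCard n R2)))
        (φ := fun z => z) (by decide) _ (hx n)
        (fun m v => dec1 n (fun t => ((v t).2.1, (v t).1)) ≠ (m.1, m.2.1) ∨
                  dec2 n (fun t => ((v t).1, (v t).2.2)) ≠ (m.1, m.2.2))
        (fun a => ((dec1 n fun t => ((a t).2.1, (a t).1)).2,
          (dec2 n fun t => ((a t).1, (a t).2.2)).2)) (fun b m v hb => by
          push Not at hb
          simp only [Equiv.refl_apply] at hb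
          simp [hb.1, hb.2]) hs hτ hc
      rw [Fintype.card_prod (Fin (msgCard n R1)), Nat.cast_mul] at this
      simpa only [Fintype.card_fin] using this

/-! ### Product laws and concavity -/

lemma sum_prod_eq_prod_sum {V : Type*} [Fintype V] {n : ℕ} (f : Fin n → V → ℝ) :
    ∑ v : Fin n → V, ∏ t, f t (v t) = ∏ t, ∑ a, f t a := by
  rw [Finset.prod_univ_sum, Fintype.piFinset_univ]

lemma IsPMF.pi {V : Type*} [Fintype V] {p : V → ℝ} (hp : IsPMF p) (n : ℕ) :
    IsPMF fun v : Fin n → V => ∏ t, p (v t) :=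
  ⟨fun v => Finset.prod_nonneg fun t _ => hp.1 _, by
    rw [sum_prod_eq_prod_sum fun (_ : Fin n) a => p a]
    simp [hp.2]⟩

lemma IsPMF.sum_mul_rpow_le {V : Type*} [Fintype V] {p : V → ℝ} (hp : IsPMF p) {f : V → ℝ}
    (hf : ∀ v, 0 ≤ f v) {ρ : ℝ} (h0 : 0 ≤ ρ) (h1 : ρ ≤ 1) :
    ∑ v, p v * f v ^ ρ ≤ (∑ v, p v * f v) ^ ρ := by
  simpa using (Real.concaveOn_rpow h0 h1).le_map_sum (t := Finset.univ) (w := p) (p := f)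
    (fun v _ => hp.1 v) hp.2 fun v _ => hf v

lemma IsPMF.exists_le {V : Type*} [Fintype V] {p : V → ℝ} (hp : IsPMF p) {f : V → ℝ} {B : ℝ}
    (h : ∑ v, p v * f v ≤ B) : ∃ v, f v ≤ B := by
  by_contra hcon
  push Not at hcon
  obtain ⟨v, hv⟩ : ∃ v, 0 < p v := by
    by_contra hn
    push Not at hn
    have : ∑ v, p v ≤ 0 := Finset.sum_nonpos fun v _ => hn v
    rw [hp.2] at this
    linarith
  have : ∑ v, p v * B < ∑ v, p v * f v :=
    Finset.sum_lt_sum (fun v _ => mul_le_mul_of_nonneg_left (hcon v).le (hp.1 v))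
      ⟨v, Finset.mem_univ v, mul_lt_mul_of_pos_left (hcon v) hv⟩
  rw [← Finset.sum_mul, hp.2] at this
  linarith

lemma sum_rpow_le {ι : Type*} (s : Finset ι) {f : ι → ℝ} (hf : ∀ i, 0 ≤ f i) {ρ : ℝ}
    (h0 : 0 < ρ) (h1 : ρ ≤ 1) : (∑ i ∈ s, f i) ^ ρ ≤ ∑ i ∈ s, f i ^ ρ := by
  induction s using Finset.induction_on with
  | empty => simp [h0.ne']
  | insert a s ha ih =>
    rw [Finset.sum_insert ha, Finset.sum_insert ha]
    exact (Real.rpow_add_le_add_rpow (hf a) (Finset.sum_nonneg fun i _ => hf i) h0.le h1).trans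
      (by gcongr)

/-- Two distinct coordinates of a uniformly random Boolean function have uniform sum. -/
lemma two_mul_sum_xor_eq {S : Type*} [Fintype S] {a b : S} (hab : a ≠ b) (α : Bool) :
    2 * ∑ f : S → Bool, (if Bool.xor (f a) (f b) = α then (1 : ℝ) else 0) =
      Fintype.card (S → Bool) := by
  have hflip : Function.Involutive fun f : S → Bool => Function.update f a (!f a) := by
    intro f
    simp
  have h : ∑ f : S → Bool, (if Bool.xor (f a) (f b) = α then (1 : ℝ) else 0) =
      ∑ f : S → Bool, (if Bool.xor (f a) (f b) = α then (0 : ℝ) else 1) := by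
    rw [← Equiv.sum_comp hflip.toPerm]
    refine Finset.sum_congr rfl fun f _ => ?_
    simp only [Function.Involutive.coe_toPerm, Function.update_self,
      Function.update_of_ne hab.symm]
    cases f a <;> cases f b <;> cases α <;> simp
  rw [two_mul]
  nth_rewrite 2 [h]
  rw [← Finset.sum_add_distrib]
  have : ∀ f : S → Bool, (if Bool.xor (f a) (f b) = α then (1 : ℝ) else 0) +
      (if Bool.xor (f a) (f b) = α then (0 : ℝ) else 1) = 1 := fun f => by
    split_ifs <;> simp
  simp only [this]
  simp

/-! ### Random coding for one receiver

A noise letter is `(z₀, z₁, z₂)` with `z₁` the noise of the receiver's own private bit and `z₂` the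
noise of the other private bit. At a time `t` with `b = A t` the common input conveys `z₁` if `b`
holds and `z₂` otherwise. -/

/-- The noise bit conveyed by the common input. -/
def pick (b : Bool) (u : Bool × Bool × Bool) : Bool := if b then u.2.1 else u.2.2

/-- The part of a noise letter the receiver can resolve. -/
def resolve (b : Bool) (u : Bool × Bool × Bool) : Bool × Bool × Bool :=
  if b then (u.1, u.2.1, false) else u

lemma resolve_fst (b : Bool) (u : Bool × Bool × Bool) : (resolve b u).1 = u.1 := by
  cases b <;> rfl

lemma resolve_snd_fst (b : Bool) (u : Bool × Bool × Bool) : (resolve b u).2.1 = u.2.1 := by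
  cases b <;> rfl

lemma pick_resolve (b : Bool) (u : Bool × Bool × Bool) : pick b (resolve b u) = pick b u := by
  cases b <;> rfl

/-- The sequence of conveyed noise bits. -/
def pickSeq {n : ℕ} (A : Fin n → Bool) (u : Fin n → Bool × Bool × Bool) : Fin n → Bool :=
  fun t => pick (A t) (u t)

/-- The part of a sequence known before time `t`. -/
def before {n : ℕ} (t : Fin n) (w : Fin n → Bool) : Fin n → Bool :=
  fun s => if s < t then w s else false

lemma before_eq_iff {n : ℕ} (t : Fin n) (w w' : Fin n → Bool) :
    before t w = before t w' ↔ ∀ s, s < t → w s = w' s := by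
  constructor
  · intro h s hs
    simpa [before, hs] using congrFun h s
  · intro h
    funext s
    unfold before
    split_ifs with hs
    · exact h s hs
    · rfl

section Receiver

variable {K K' L Γ : Type*} {n : ℕ}

/-- The pair of bits received at time `t`. -/
def received (c : Γ → K × L → Bool) (h : Γ → (K × K') × (Fin n → Bool) → Bool) (A : Fin n → Bool)
    (γ : Fin n → Γ) (m : K × L) (k' : K') (u : Fin n → Bool × Bool × Bool) (t : Fin n) :
    Bool × Bool :=
  (Bool.xor (h (γ t) ((m.1, k'), before t (pickSeq A u))) (u t).1, Bool.xor (c (γ t) m) (u t).2.1)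

/-- `m` is the unique message having an explanation of the observation `y` of maximal metric. -/
def IsBest (c : Γ → K × L → Bool) (h : Γ → (K × K') × (Fin n → Bool) → Bool) (A : Fin n → Bool)
    (q : Bool → Bool × Bool × Bool → ℝ) (γ : Fin n → Γ) (y : Fin n → Bool × Bool) (m : K × L) :
    Prop :=
  ∃ k' u, received c h A γ m k' u = y ∧ ∀ m', m' ≠ m → ∀ k'' u',
    received c h A γ m' k'' u' = y → ∏ t, q (A t) (u' t) < ∏ t, q (A t) (u t)

/-- The decoder choosing the message whose explanation has the largest metric. -/
def bestDec [Nonempty (K × L)] (c : Γ → K × L → Bool)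
    (h : Γ → (K × K') × (Fin n → Bool) → Bool) (A : Fin n → Bool)
    (q : Bool → Bool × Bool × Bool → ℝ) (γ : Fin n → Γ) (y : Fin n → Bool × Bool) : K × L :=
  Classical.epsilon (IsBest c h A q γ y)

lemma IsBest.unique {c : Γ → K × L → Bool} {h : Γ → (K × K') × (Fin n → Bool) → Bool}
    {A : Fin n → Bool} {q : Bool → Bool × Bool × Bool → ℝ} {γ : Fin n → Γ}
    {y : Fin n → Bool × Bool} {m m' : K × L} (hm : IsBest c h A q γ y m)
    (hm' : IsBest c h A q γ y m') : m = m' := by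
  by_contra hne
  obtain ⟨k, u, hu, hb⟩ := hm
  obtain ⟨k', u', hu', hb'⟩ := hm'
  exact lt_asymm (hb m' (Ne.symm hne) k' u' hu') (hb' m hne k u hu)

/-- If the decoder errs, a wrong message explains the observation at least as well as a given
explanation with the true message. -/
lemma exists_of_bestDec_ne [Nonempty (K × L)] {c : Γ → K × L → Bool}
    {h : Γ → (K × K') × (Fin n → Bool) → Bool} {A : Fin n → Bool}
    {q : Bool → Bool × Bool × Bool → ℝ} {γ : Fin n → Γ} {y : Fin n → Bool × Bool} {m : K × L}
    {k' : K'} {u : Fin n → Bool × Bool × Bool} (hu : received c h A γ m k' u = y)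
    (hne : bestDec c h A q γ y ≠ m) :
    ∃ m', m' ≠ m ∧ ∃ k'' u', received c h A γ m' k'' u' = y ∧
      ∏ t, q (A t) (u t) ≤ ∏ t, q (A t) (u' t) := by
  by_contra hcon
  push Not at hcon
  have hb : IsBest c h A q γ y m := ⟨k', u, hu, hcon⟩
  exact hne ((Classical.epsilon_spec (p := IsBest c h A q γ y) ⟨m, hb⟩).unique hb)

lemma received_resolve (c : Γ → K × L → Bool) (h : Γ → (K × K') × (Fin n → Bool) → Bool)
    (A : Fin n → Bool) (γ : Fin n → Γ) (m : K × L) (k' : K') (z : Fin n → Bool × Bool × Bool) :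
    received c h A γ m k' (fun t => resolve (A t) (z t)) = received c h A γ m k' z := by
  have h1 : pickSeq A (fun t => resolve (A t) (z t)) = pickSeq A z := by
    funext t
    exact pick_resolve _ _
  funext t
  unfold received
  rw [h1, resolve_fst, resolve_snd_fst]

end Receiver

/-- Tilted likelihood ratio of the resolvable parts of two noise letters. -/
def likeRatio (p : Bool × Bool × Bool → ℝ) (θ : ℝ) (b : Bool) (z u : Bool × Bool × Bool) : ℝ :=
  (distOf p (resolve b) u / distOf p (resolve b) (resolve b z)) ^ θ

/-- Likelihood ratio averaged over independent received pairs. -/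
def freeSum (p : Bool × Bool × Bool → ℝ) (θ : ℝ) (b : Bool) (z : Bool × Bool × Bool) : ℝ :=
  (∑ u, likeRatio p θ b z u) / 4

/-- Likelihood ratio averaged over received pairs sharing the common bit and what it conveys. -/
def boundSum (p : Bool × Bool × Bool → ℝ) (θ : ℝ) (b : Bool) (z : Bool × Bool × Bool) : ℝ :=
  (∑ u, if u.1 = z.1 ∧ pick b u = pick b z then likeRatio p θ b z u else 0) / 2

lemma likeRatio_nonneg {p : Bool × Bool × Bool → ℝ} (hp : IsPMF p) (θ : ℝ) (b : Bool)
    (z u : Bool × Bool × Bool) : 0 ≤ likeRatio p θ b z u :=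
  Real.rpow_nonneg (div_nonneg (distOf_nonneg hp.1 _ _) (distOf_nonneg hp.1 _ _)) _

lemma freeSum_nonneg {p : Bool × Bool × Bool → ℝ} (hp : IsPMF p) (θ : ℝ) (b : Bool)
    (z : Bool × Bool × Bool) : 0 ≤ freeSum p θ b z :=
  div_nonneg (Finset.sum_nonneg fun u _ => likeRatio_nonneg hp θ b z u) (by norm_num)

lemma boundSum_nonneg {p : Bool × Bool × Bool → ℝ} (hp : IsPMF p) (θ : ℝ) (b : Bool)
    (z : Bool × Bool × Bool) : 0 ≤ boundSum p θ b z := by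
  refine div_nonneg (Finset.sum_nonneg fun u _ => ?_) (by norm_num)
  split_ifs
  · exact likeRatio_nonneg hp θ b z u
  · exact le_rfl

/-- Pairwise independence of the received letters produced by a random codebook letter. -/
def IndepLetters {Γ M S : Type*} [Fintype Γ] (W : Γ → ℝ) (c : Γ → M → Bool) (h : Γ → S → Bool) :
    Prop :=
  ∀ m m', m' ≠ m → ∀ κ κ' α α' β β', ∑ γ, W γ *
    (if (Bool.xor (h γ κ') α', Bool.xor (c γ m') β') =
      (Bool.xor (h γ κ) α, Bool.xor (c γ m) β) then 1 else 0) ≤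
    if κ' = κ then (if α' = α then 1 / 2 else 0) else 1 / 4

section Receiver

variable {K K' L Γ : Type*} {n : ℕ}

/-- Probability that a wrong message with given noise explains the observation. -/
lemma prob_received_eq_le [Fintype Γ] {W : Γ → ℝ} (hW : IsPMF W) {c : Γ → K × L → Bool}
    {h : Γ → (K × K') × (Fin n → Bool) → Bool} (hind : IndepLetters W c h) (A : Fin n → Bool)
    {m m' : K × L} (hm : m' ≠ m) (k k' : K') (z u : Fin n → Bool × Bool × Bool) :
    ∑ γ : Fin n → Γ, (∏ t, W (γ t)) *
        (if received c h A γ m' k' u = received c h A γ m k z then 1 else 0) ≤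
      ∏ t, if ((m'.1, k'), before t (pickSeq A u)) = ((m.1, k), before t (pickSeq A z))
        then (if (u t).1 = (z t).1 then 1 / 2 else 0) else 1 / 4 := by
  have h1 : ∀ γ : Fin n → Γ, (∏ t, W (γ t)) *
        (if received c h A γ m' k' u = received c h A γ m k z then (1 : ℝ) else 0) =
      ∏ t, (W (γ t) * if received c h A γ m' k' u t = received c h A γ m k z t then 1 else 0) := by
    intro γ
    rw [Finset.prod_mul_distrib, Fintype.prod_boole]
    simp only [funext_iff]
    congr
  simp only [h1]
  refine (sum_prod_eq_prod_sum (fun t g => W g *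
    if (Bool.xor (h g ((m'.1, k'), before t (pickSeq A u))) (u t).1,
        Bool.xor (c g m') (u t).2.1) =
      (Bool.xor (h g ((m.1, k), before t (pickSeq A z))) (z t).1, Bool.xor (c g m) (z t).2.1)
      then (1 : ℝ) else 0)).trans_le ?_
  refine Finset.prod_le_prod (fun t _ => Finset.sum_nonneg fun g _ =>
    mul_nonneg (hW.1 g) (by split_ifs <;> norm_num)) fun t _ => ?_
  refine (hind m m' hm ((m.1, k), before t (pickSeq A z)) ((m'.1, k'), before t (pickSeq A u))
    (z t).1 (u t).1 (z t).2.1 (u t).2.1).trans_eq ?_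
  congr

/-- An error forces the sum of tilted likelihood ratios of wrong explanations above `1`. -/
lemma err_le_sum_likeRatio [Fintype K] [Fintype K'] [Fintype L] [Nonempty (K × L)]
    {p : Bool × Bool × Bool → ℝ} (hp : IsPMF p) (c : Γ → K × L → Bool)
    (h : Γ → (K × K') × (Fin n → Bool) → Bool) (A : Fin n → Bool) (γ : Fin n → Γ) (m : K × L)
    (k : K') {z : Fin n → Bool × Bool × Bool} (hz : ∀ t, 0 < p (z t)) {θ ρ : ℝ} (hθ : 0 ≤ θ)
    (hρ : 0 ≤ ρ) :
    (if bestDec c h A (fun b => distOf p (resolve b)) γ (received c h A γ m k z) ≠ m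
      then (1 : ℝ) else 0) ≤
    (∑ m', if m' ≠ m then ∑ k', ∑ u : Fin n → Bool × Bool × Bool,
      (if received c h A γ m' k' u = received c h A γ m k z then (1 : ℝ) else 0) *
        ∏ t, likeRatio p θ (A t) (z t) (u t) else 0) ^ ρ := by
  have hterm : ∀ m' k' (u : Fin n → Bool × Bool × Bool),
      0 ≤ (if received c h A γ m' k' u = received c h A γ m k z then (1 : ℝ) else 0) *
        ∏ t, likeRatio p θ (A t) (z t) (u t) := fun m' k' u =>
    mul_nonneg (by split_ifs <;> norm_num)
      (Finset.prod_nonneg fun t _ => likeRatio_nonneg hp _ _ _ _)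
  have hterm' : ∀ m', 0 ≤ if m' ≠ m then ∑ k', ∑ u : Fin n → Bool × Bool × Bool,
      (if received c h A γ m' k' u = received c h A γ m k z then (1 : ℝ) else 0) *
        ∏ t, likeRatio p θ (A t) (z t) (u t) else 0 := fun m' => by
    split_ifs
    · exact Finset.sum_nonneg fun k' _ => Finset.sum_nonneg fun u _ => hterm m' k' u
    · exact le_rfl
  split_ifs with herr
  · obtain ⟨m', hm', k', u, hu, hle⟩ := exists_of_bestDec_ne
      (received_resolve c h A γ m k z) herr
    have hq : ∀ t, 0 < distOf p (resolve (A t)) (resolve (A t) (z t)) := fun t =>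
      (hz t).trans_le (le_distOf hp.1 _ _)
    refine Real.one_le_rpow ?_ hρ
    refine le_trans ?_ (Finset.single_le_sum (fun m' _ => hterm' m') (Finset.mem_univ m'))
    rw [if_pos hm']
    refine le_trans ?_ (Finset.single_le_sum
      (fun k' _ => Finset.sum_nonneg fun u _ => hterm m' k' u) (Finset.mem_univ k'))
    refine le_trans ?_ (Finset.single_le_sum (fun u _ => hterm m' k' u) (Finset.mem_univ u))
    rw [if_pos hu, one_mul]
    unfold likeRatio
    rw [Real.finsetProd_rpow _ _ fun t _ =>
      div_nonneg (distOf_nonneg hp.1 _ _) (distOf_nonneg hp.1 _ _)]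
    refine Real.one_le_rpow ?_ hθ
    rw [Finset.prod_div_distrib, one_le_div (Finset.prod_pos fun t _ => hq t)]
    exact hle
  · exact Real.rpow_nonneg (Finset.sum_nonneg fun m' _ => hterm' m') _

/-- Factors of the bound for an explanation first diverging at time `s`. -/
def divergeFactor (p : Bool × Bool × Bool → ℝ) (θ : ℝ) (s t : ℕ) (b : Bool)
    (z : Bool × Bool × Bool) : ℝ :=
  if t < s then boundSum p θ b z else (if t = s then 2 else 1) * freeSum p θ b z

lemma divergeFactor_nonneg {p : Bool × Bool × Bool → ℝ} (hp : IsPMF p) (θ : ℝ) (s t : ℕ)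
    (b : Bool) (z : Bool × Bool × Bool) : 0 ≤ divergeFactor p θ s t b z := by
  unfold divergeFactor
  split_ifs
  · exact boundSum_nonneg hp _ _ _
  · exact mul_nonneg (by norm_num) (freeSum_nonneg hp _ _ _)
  · exact mul_nonneg (by norm_num) (freeSum_nonneg hp _ _ _)

/-- Explanations with the same key, sorted according to their first divergence. -/
lemma sum_same_key_le {p : Bool × Bool × Bool → ℝ} (hp : IsPMF p) (A : Fin n → Bool) (θ : ℝ)
    (z : Fin n → Bool × Bool × Bool) :
    ∑ u : Fin n → Bool × Bool × Bool,
      (∏ t, if before t (pickSeq A u) = before t (pickSeq A z)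
        then (if (u t).1 = (z t).1 then (1 / 2 : ℝ) else 0) else 1 / 4) *
        ∏ t, likeRatio p θ (A t) (z t) (u t) ≤
      ∑ s ∈ Finset.range (n + 1), ∏ t : Fin n, divergeFactor p θ s t (A t) (z t) := by
  let e : ℕ → Fin n → Bool × Bool × Bool → ℝ := fun s t u =>
    if (t : ℕ) < s then (if u.1 = (z t).1 ∧ pick (A t) u = pick (A t) (z t) then 1 / 2 else 0)
    else (if (t : ℕ) = s then 2 else 1) * (1 / 4)
  have he : ∀ s t u, 0 ≤ e s t u := by
    intro s t u
    simp only [e]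
    split_ifs <;> norm_num
  have hex : ∀ u : Fin n → Bool × Bool × Bool, ∃ s ∈ Finset.range (n + 1), ∀ t : Fin n,
      (if before t (pickSeq A u) = before t (pickSeq A z)
        then (if (u t).1 = (z t).1 then (1 / 2 : ℝ) else 0) else 1 / 4) ≤ e s t (u t) := by
    intro u
    by_cases hall : ∃ s : ℕ, ∃ hs : s < n, pickSeq A u ⟨s, hs⟩ ≠ pickSeq A z ⟨s, hs⟩
    · have hspec := Nat.find_spec hall
      have hmin := fun r => Nat.find_min (m := r) hall
      set s := Nat.find hall
      obtain ⟨hs, hne⟩ := hspec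
      refine ⟨s, Finset.mem_range.2 (by omega), fun t => ?_⟩
      have heq : ∀ r : Fin n, (r : ℕ) < s → pickSeq A u r = pickSeq A z r := by
        intro r hr
        have := hmin r hr
        push Not at this
        exact this r.2
      simp only [e]
      rcases lt_trichotomy (t : ℕ) s with h | h | h
      · have h2 : before t (pickSeq A u) = before t (pickSeq A z) :=
          (before_eq_iff _ _ _).2 fun r hr => heq r (lt_trans hr h)
        have h3 : pick (A t) (u t) = pick (A t) (z t) := heq t h
        simp [h, h2, h3]
      · simp only [h, lt_irrefl, if_false, if_true]
        split_ifs <;> norm_num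
      · have h2 : ¬ before t (pickSeq A u) = before t (pickSeq A z) := fun h' =>
          hne ((before_eq_iff _ _ _).1 h' ⟨s, hs⟩ h)
        simp [not_lt.2 h.le, h.ne', h2]
    · push Not at hall
      refine ⟨n, Finset.mem_range.2 (by omega), fun t => ?_⟩
      have heq : ∀ r : Fin n, pickSeq A u r = pickSeq A z r := fun r => hall r r.2
      have h2 : before t (pickSeq A u) = before t (pickSeq A z) :=
        (before_eq_iff _ _ _).2 fun r hr => heq r
      have h3 : pick (A t) (u t) = pick (A t) (z t) := heq t
      simp [e, t.2, h2, h3]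
  calc _ ≤ ∑ u : Fin n → Bool × Bool × Bool, ∑ s ∈ Finset.range (n + 1),
        ∏ t, (e s t (u t) * likeRatio p θ (A t) (z t) (u t)) := by
        refine Finset.sum_le_sum fun u _ => ?_
        obtain ⟨s, hs, hle⟩ := hex u
        refine le_trans ?_ (Finset.single_le_sum (f := fun s =>
          ∏ t, (e s t (u t) * likeRatio p θ (A t) (z t) (u t))) (fun s _ =>
            Finset.prod_nonneg fun t _ => mul_nonneg (he _ _ _) (likeRatio_nonneg hp _ _ _ _)) hs)
        rw [Finset.prod_mul_distrib]
        refine mul_le_mul_of_nonneg_right (Finset.prod_le_prod (fun t _ => ?_) fun t _ => hle t)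
          (Finset.prod_nonneg fun t _ => likeRatio_nonneg hp _ _ _ _)
        split_ifs <;> norm_num
    _ = _ := by
        rw [Finset.sum_comm]
        refine Finset.sum_congr rfl fun s _ => ?_
        rw [sum_prod_eq_prod_sum fun t u => e s t u * likeRatio p θ (A t) (z t) u]
        refine Finset.prod_congr rfl fun t _ => ?_
        simp only [e, divergeFactor, boundSum, freeSum]
        by_cases h : (t : ℕ) < s
        · simp only [h, if_true]
          rw [Finset.sum_div]
          refine Finset.sum_congr rfl fun u _ => ?_
          split_ifs <;> ring
        · simp only [h, if_false]
          rw [← Finset.mul_sum]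
          ring

/-- Number of wrong messages with a different and with the same key. -/
lemma sum_wrong_le [Fintype K] [Fintype K'] [Fintype L] (m : K × L) (k : K') {X Y : ℝ}
    (hX : 0 ≤ X) :
    ∑ m' : K × L, (if m' ≠ m then ∑ k' : K', (if (m'.1, k') = (m.1, k) then Y else X) else 0) ≤
      (((Fintype.card K : ℝ) * Fintype.card K' - 1) * Fintype.card L) * X +
        ((Fintype.card L : ℝ) - 1) * Y := by
  have hle : ∀ m' : K × L,
      (if m' ≠ m then ∑ k' : K', (if (m'.1, k') = (m.1, k) then Y else X) else 0) ≤
      ∑ k' : K', ((X - (if m'.1 = m.1 then (if k' = k then X else 0) else 0)) +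
        (if m'.1 = m.1 then (if k' = k then (Y - if m'.2 = m.2 then Y else 0) else 0) else 0)) := by
    intro m'
    by_cases h : m' = m
    · subst h
      simp only [ne_eq, not_true_eq_false, if_false, if_true, sub_self]
      refine Finset.sum_nonneg fun k' _ => ?_
      split_ifs <;> simp [hX]
    · simp only [ne_eq, h, not_false_eq_true, if_true]
      refine Finset.sum_le_sum fun k' _ => ?_
      have h' : m'.1 = m.1 → m'.2 ≠ m.2 := fun h1 h2 => h (Prod.ext h1 h2)
      by_cases h1 : m'.1 = m.1
      · by_cases h2 : k' = k <;> simp [h1, h2, h' h1]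
      · simp [h1]
  refine (Finset.sum_le_sum fun m' _ => hle m').trans (le_of_eq ?_)
  rw [Fintype.sum_prod_type]
  simp only [Finset.sum_add_distrib, Finset.sum_sub_distrib, Finset.sum_ite_irrel,
    Finset.sum_ite_eq', Finset.sum_const_zero, Finset.mem_univ, if_true, Finset.sum_const,
    Finset.card_univ, nsmul_eq_mul]
  ring

/-- Averaged error of the receiver for a fixed noise sequence. -/
lemma sum_codebook_err_le [Fintype Γ] [Fintype K] [Fintype K'] [Fintype L] [Nonempty (K × L)]
    {W : Γ → ℝ} (hW : IsPMF W) {c : Γ → K × L → Bool}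
    {h : Γ → (K × K') × (Fin n → Bool) → Bool} (hind : IndepLetters W c h)
    {p : Bool × Bool × Bool → ℝ} (hp : IsPMF p) (A : Fin n → Bool) (m : K × L)
    (k : K') {z : Fin n → Bool × Bool × Bool} (hz : ∀ t, 0 < p (z t)) {θ ρ : ℝ} (hθ : 0 ≤ θ)
    (hρ : 0 ≤ ρ) (hρ1 : ρ ≤ 1) :
    ∑ γ : Fin n → Γ, (∏ t, W (γ t)) *
      (if bestDec c h A (fun b => distOf p (resolve b)) γ (received c h A γ m k z) ≠ m
        then (1 : ℝ) else 0) ≤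
    ((((Fintype.card K : ℝ) * Fintype.card K' - 1) * Fintype.card L) *
        ∏ t, freeSum p θ (A t) (z t) +
      ((Fintype.card L : ℝ) - 1) * ∑ s ∈ Finset.range (n + 1),
        ∏ t : Fin n, divergeFactor p θ s t (A t) (z t)) ^ ρ := by
  have hnn : ∀ (γ : Fin n → Γ) m', 0 ≤ if m' ≠ m then ∑ k', ∑ u : Fin n → Bool × Bool × Bool,
      (if received c h A γ m' k' u = received c h A γ m k z then (1 : ℝ) else 0) *
        ∏ t, likeRatio p θ (A t) (z t) (u t) else 0 := fun γ m' => by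
    split_ifs
    · exact Finset.sum_nonneg fun k' _ => Finset.sum_nonneg fun u _ =>
        mul_nonneg (by split_ifs <;> norm_num)
          (Finset.prod_nonneg fun t _ => likeRatio_nonneg hp _ _ _ _)
    · exact le_rfl
  refine (Finset.sum_le_sum fun γ _ => mul_le_mul_of_nonneg_left
    (err_le_sum_likeRatio hp c h A γ m k hz hθ hρ) ((hW.pi n).1 γ)).trans ?_
  refine ((hW.pi n).sum_mul_rpow_le (fun γ => Finset.sum_nonneg fun m' _ => hnn γ m') hρ
    hρ1).trans ?_
  refine Real.rpow_le_rpow (Finset.sum_nonneg fun γ _ => mul_nonneg ((hW.pi n).1 γ)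
    (Finset.sum_nonneg fun m' _ => hnn γ m')) ?_ hρ
  refine le_trans ?_ (sum_wrong_le m k
    (Finset.prod_nonneg fun t _ => freeSum_nonneg hp θ (A t) (z t)))
  simp only [Finset.mul_sum]
  rw [Finset.sum_comm]
  refine Finset.sum_le_sum fun m' _ => ?_
  by_cases hm : m' = m
  · simp [hm]
  simp only [ne_eq, hm, not_false_eq_true, if_true, Finset.mul_sum]
  rw [Finset.sum_comm]
  refine Finset.sum_le_sum fun k' _ => ?_
  rw [Finset.sum_comm]
  have hswap : ∀ u : Fin n → Bool × Bool × Bool, ∑ γ : Fin n → Γ, (∏ t, W (γ t)) *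
      ((if received c h A γ m' k' u = received c h A γ m k z then (1 : ℝ) else 0) *
        ∏ t, likeRatio p θ (A t) (z t) (u t)) ≤
      (∏ t, if ((m'.1, k'), before t (pickSeq A u)) = ((m.1, k), before t (pickSeq A z))
        then (if (u t).1 = (z t).1 then 1 / 2 else 0) else 1 / 4) *
        ∏ t, likeRatio p θ (A t) (z t) (u t) := by
    intro u
    simp only [← mul_assoc]
    rw [← Finset.sum_mul]
    exact mul_le_mul_of_nonneg_right (prob_received_eq_le hW hind A hm k k' z u)
      (Finset.prod_nonneg fun t _ => likeRatio_nonneg hp _ _ _ _)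
  refine (Finset.sum_le_sum fun u _ => hswap u).trans ?_
  by_cases hkey : (m'.1, k') = (m.1, k)
  · simp only [hkey, if_true, Prod.mk.injEq, true_and]
    exact sum_same_key_le hp A θ z
  · rw [if_neg hkey]
    have : ∀ (u : Fin n → Bool × Bool × Bool) t, ¬ ((m'.1, k'), before t (pickSeq A u)) =
        ((m.1, k), before t (pickSeq A z)) := fun u t h' => hkey (Prod.mk.inj h').1
    simp only [this, if_false, ← Finset.prod_mul_distrib]
    rw [sum_prod_eq_prod_sum fun t u => 1 / 4 * likeRatio p θ (A t) (z t) u]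
    refine le_of_eq (Finset.prod_congr rfl fun t _ => ?_)
    rw [← Finset.mul_sum, freeSum]
    ring

/-- Averaged error of the receiver. -/
lemma sum_codebook_noise_err_le [Fintype Γ] [Fintype K] [Fintype K'] [Fintype L] [Nonempty K] [Nonempty K']
    [Nonempty L] {W : Γ → ℝ} (hW : IsPMF W) {c : Γ → K × L → Bool}
    {h : Γ → (K × K') × (Fin n → Bool) → Bool} (hind : IndepLetters W c h)
    {p : Bool × Bool × Bool → ℝ} (hp : IsPMF p) (A : Fin n → Bool) (m : K × L)
    (k : K') {θ ρ : ℝ} (hθ : 0 ≤ θ) (hρ : 0 < ρ) (hρ1 : ρ ≤ 1) {f κ : Bool → ℝ}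
    (hf : ∀ b, ∑ z, p z * freeSum p θ b z ^ ρ ≤ f b)
    (hfκ : ∀ b, ∑ z, p z * freeSum p θ b z ^ ρ ≤ κ b)
    (hgκ : ∀ b, ∑ z, p z * boundSum p θ b z ^ ρ ≤ κ b) :
    ∑ γ : Fin n → Γ, (∏ t, W (γ t)) * ∑ z : Fin n → Bool × Bool × Bool, (∏ t, p (z t)) *
      (if bestDec c h A (fun b => distOf p (resolve b)) γ (received c h A γ m k z) ≠ m
        then (1 : ℝ) else 0) ≤
    (((Fintype.card K : ℝ) * Fintype.card K' - 1) * Fintype.card L) ^ ρ * ∏ t, f (A t) +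
      ((Fintype.card L : ℝ) - 1) ^ ρ * ((n + 1) * (2 * ∏ t, κ (A t))) := by
  have hK : (1 : ℝ) ≤ Fintype.card K := by exact_mod_cast Fintype.card_pos (α := K)
  have hK' : (1 : ℝ) ≤ Fintype.card K' := by exact_mod_cast Fintype.card_pos (α := K')
  have hL : (1 : ℝ) ≤ Fintype.card L := by exact_mod_cast Fintype.card_pos (α := L)
  have hNi : 0 ≤ (((Fintype.card K : ℝ) * Fintype.card K' - 1) * Fintype.card L) :=
    mul_nonneg (by nlinarith) (by linarith)
  have hNii : 0 ≤ (Fintype.card L : ℝ) - 1 := by linarith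
  set Ni := (((Fintype.card K : ℝ) * Fintype.card K' - 1) * Fintype.card L)
  set Nii := (Fintype.card L : ℝ) - 1
  have hF0 : ∀ b, 0 ≤ ∑ z, p z * freeSum p θ b z ^ ρ := fun b =>
    Finset.sum_nonneg fun z _ => mul_nonneg (hp.1 z) (Real.rpow_nonneg (freeSum_nonneg hp _ _ _) _)
  have hκ0 : ∀ b, 0 ≤ κ b := fun b => (hF0 b).trans (hfκ b)
  have hdf : ∀ s (t : Fin n), ∑ z, p z * divergeFactor p θ s t (A t) z ^ ρ ≤
      (if (t : ℕ) = s then 2 else 1) * κ (A t) := by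
    intro s t
    rcases lt_trichotomy (t : ℕ) s with h | h | h
    · simp only [divergeFactor, h, h.ne, if_true, if_false, one_mul]
      exact hgκ _
    · simp only [divergeFactor, h, lt_irrefl, if_true, if_false]
      calc ∑ z, p z * (2 * freeSum p θ (A t) z) ^ ρ
          = 2 ^ ρ * ∑ z, p z * freeSum p θ (A t) z ^ ρ := by
            rw [Finset.mul_sum]
            refine Finset.sum_congr rfl fun z _ => ?_
            rw [Real.mul_rpow (by norm_num) (freeSum_nonneg hp _ _ _)]
            ring
        _ ≤ 2 * κ (A t) := by
            refine mul_le_mul ?_ (hfκ _) (hF0 _) (by norm_num)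
            calc (2 : ℝ) ^ ρ ≤ 2 ^ (1 : ℝ) := Real.rpow_le_rpow_of_exponent_le (by norm_num) hρ1
              _ = 2 := Real.rpow_one 2
    · simp only [divergeFactor, not_lt.2 h.le, h.ne', if_false, one_mul]
      exact hfκ _
  have hpt : ∀ z : Fin n → Bool × Bool × Bool, ∑ γ : Fin n → Γ, (∏ t, W (γ t)) *
      ((∏ t, p (z t)) *
        (if bestDec c h A (fun b => distOf p (resolve b)) γ (received c h A γ m k z) ≠ m
          then (1 : ℝ) else 0)) ≤
      Ni ^ ρ * ∏ t, (p (z t) * freeSum p θ (A t) (z t) ^ ρ) +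
        Nii ^ ρ * ∑ s ∈ Finset.range (n + 1),
          ∏ t : Fin n, (p (z t) * divergeFactor p θ s t (A t) (z t) ^ ρ) := by
    intro z
    simp only [mul_left_comm _ (∏ t, p (z t))]
    rw [← Finset.mul_sum]
    simp only [Finset.prod_mul_distrib]
    rw [← Finset.mul_sum, mul_left_comm, mul_left_comm (Nii ^ ρ), ← mul_add]
    by_cases hz : ∀ t, 0 < p (z t)
    · refine mul_le_mul_of_nonneg_left ?_ ((hp.pi n).1 z)
      refine (sum_codebook_err_le hW hind hp A m k hz hθ hρ.le hρ1).trans ?_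
      have hX : 0 ≤ ∏ t, freeSum p θ (A t) (z t) :=
        Finset.prod_nonneg fun t _ => freeSum_nonneg hp _ _ _
      have hY : ∀ s, 0 ≤ ∏ t : Fin n, divergeFactor p θ s t (A t) (z t) := fun s =>
        Finset.prod_nonneg fun t _ => divergeFactor_nonneg hp _ _ _ _ _
      refine (Real.rpow_add_le_add_rpow (mul_nonneg hNi hX)
        (mul_nonneg hNii (Finset.sum_nonneg fun s _ => hY s)) hρ.le hρ1).trans ?_
      rw [Real.mul_rpow hNi hX, Real.mul_rpow hNii (Finset.sum_nonneg fun s _ => hY s)]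
      refine add_le_add (le_of_eq ?_) (mul_le_mul_of_nonneg_left ?_ (Real.rpow_nonneg hNii _))
      · rw [Real.finsetProd_rpow _ _ fun t _ => freeSum_nonneg hp _ _ _]
      · refine (sum_rpow_le _ hY hρ hρ1).trans (le_of_eq (Finset.sum_congr rfl fun s _ => ?_))
        rw [Real.finsetProd_rpow _ _ fun t _ => divergeFactor_nonneg hp _ _ _ _ _]
    · push Not at hz
      obtain ⟨t, ht⟩ := hz
      have : ∏ t, p (z t) = 0 :=
        Finset.prod_eq_zero (Finset.mem_univ t) (le_antisymm ht (hp.1 _))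
      rw [this, zero_mul, zero_mul]
  calc _ = ∑ z : Fin n → Bool × Bool × Bool, ∑ γ : Fin n → Γ, (∏ t, W (γ t)) *
      ((∏ t, p (z t)) *
        (if bestDec c h A (fun b => distOf p (resolve b)) γ (received c h A γ m k z) ≠ m
          then (1 : ℝ) else 0)) := by
        simp only [Finset.mul_sum]
        rw [Finset.sum_comm]
    _ ≤ _ := Finset.sum_le_sum fun z _ => hpt z
    _ = Ni ^ ρ * ∏ t, (∑ z, p z * freeSum p θ (A t) z ^ ρ) +
        Nii ^ ρ * ∑ s ∈ Finset.range (n + 1),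
          ∏ t : Fin n, (∑ z, p z * divergeFactor p θ s t (A t) z ^ ρ) := by
        rw [Finset.sum_add_distrib, ← Finset.mul_sum, ← Finset.mul_sum, Finset.sum_comm]
        rw [sum_prod_eq_prod_sum fun t z => p z * freeSum p θ (A t) z ^ ρ]
        congr 2
        refine Finset.sum_congr rfl fun s _ => ?_
        rw [sum_prod_eq_prod_sum fun (t : Fin n) z => p z * divergeFactor p θ s t (A t) z ^ ρ]
    _ ≤ Ni ^ ρ * ∏ t, f (A t) + Nii ^ ρ * ∑ s ∈ Finset.range (n + 1), 2 * ∏ t, κ (A t) := by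
        refine add_le_add (mul_le_mul_of_nonneg_left
          (Finset.prod_le_prod (fun t _ => hF0 _) fun t _ => hf _) (Real.rpow_nonneg hNi _))
          (mul_le_mul_of_nonneg_left (Finset.sum_le_sum fun s _ => ?_) (Real.rpow_nonneg hNii _))
        refine (Finset.prod_le_prod (fun t _ => Finset.sum_nonneg fun z _ => mul_nonneg (hp.1 z)
          (Real.rpow_nonneg (divergeFactor_nonneg hp _ _ _ _ _) _)) fun t _ => hdf s t).trans ?_
        rw [Finset.prod_mul_distrib]
        refine mul_le_mul_of_nonneg_right ?_ (Finset.prod_nonneg fun t _ => hκ0 _)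
        by_cases hs : s < n
        · have : ∀ t : Fin n, (t : ℕ) = s ↔ t = ⟨s, hs⟩ := fun t => by simp [Fin.ext_iff]
          simp only [this, Finset.prod_ite_eq', Finset.mem_univ, if_true]
          exact le_rfl
        · have : ∀ t : Fin n, (t : ℕ) ≠ s := fun t h => hs (h ▸ t.2)
          simp [this]
    _ = _ := by
        simp only [Finset.sum_const, Finset.card_range, nsmul_eq_mul]
        push_cast
        ring

end Receiver

/-! ### Uniform codebook letters -/

/-- The uniform law. -/
def unif (V : Type*) [Fintype V] : V → ℝ := fun _ => 1 / (Fintype.card V : ℝ)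

lemma isPMF_unif (V : Type*) [Fintype V] [Nonempty V] : IsPMF (unif V) := by
  refine ⟨fun v => by unfold unif; positivity, ?_⟩
  have : (Fintype.card V : ℝ) ≠ 0 := by exact_mod_cast Fintype.card_ne_zero
  simp [unif, this]

lemma sum_unif_xor_eq {S : Type*} [Fintype S] {a b : S} (hab : a ≠ b) (α β : Bool) :
    ∑ f, unif (S → Bool) f * (if Bool.xor (f a) α = Bool.xor (f b) β then (1 : ℝ) else 0) =
      1 / 2 := by
  have h1 : ∀ f : S → Bool, (Bool.xor (f a) α = Bool.xor (f b) β) =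
      (Bool.xor (f a) (f b) = Bool.xor α β) := fun f => by
    cases f a <;> cases f b <;> cases α <;> cases β <;> simp
  have h2 : (Fintype.card (S → Bool) : ℝ) ≠ 0 := by exact_mod_cast Fintype.card_ne_zero
  have h3 := two_mul_sum_xor_eq hab (Bool.xor α β)
  simp only [unif, h1]
  rw [← Finset.mul_sum]
  field_simp
  linarith

lemma sum_unif_xor_eq_ite {S : Type*} [Fintype S] (a b : S) (α β : Bool) :
    ∑ f, unif (S → Bool) f * (if Bool.xor (f a) α = Bool.xor (f b) β then (1 : ℝ) else 0) =
      if a = b then (if α = β then 1 else 0) else 1 / 2 := by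
  by_cases hab : a = b
  · subst hab
    simp only [if_true]
    by_cases h : α = β
    · simp [h, (isPMF_unif (S → Bool)).2]
    · simp [h]
  · rw [if_neg hab]
    exact sum_unif_xor_eq hab α β

/-- Codebook letters: two private bits and the common bit, for all messages. -/
abbrev Letter (M₁ M₂ S : Type*) := (M₁ → Bool) × (M₂ → Bool) × (S → Bool)

/-- The uniform law of codebook letters. -/
def letterLaw (M₁ M₂ S : Type*) [Fintype M₁] [Fintype M₂] [Fintype S] : Letter M₁ M₂ S → ℝ :=
  fun γ => unif (M₁ → Bool) γ.1 * (unif (M₂ → Bool) γ.2.1 * unif (S → Bool) γ.2.2)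

lemma sum_letterLaw {M₁ M₂ S : Type*} [Fintype M₁] [Fintype M₂] [Fintype S]
    (f₁ : (M₁ → Bool) → ℝ) (f₂ : (M₂ → Bool) → ℝ) (g : (S → Bool) → ℝ) :
    ∑ γ, letterLaw M₁ M₂ S γ * (f₁ γ.1 * (f₂ γ.2.1 * g γ.2.2)) =
      (∑ x, unif (M₁ → Bool) x * f₁ x) *
        ((∑ x, unif (M₂ → Bool) x * f₂ x) * ∑ x, unif (S → Bool) x * g x) := by
  simp only [letterLaw, Fintype.sum_prod_type]
  rw [Finset.sum_mul]
  refine Finset.sum_congr rfl fun x _ => ?_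
  rw [Finset.sum_mul_sum, Finset.mul_sum]
  refine Finset.sum_congr rfl fun y _ => ?_
  rw [Finset.mul_sum]
  refine Finset.sum_congr rfl fun w _ => ?_
  ring

lemma isPMF_letterLaw (M₁ M₂ S : Type*) [Fintype M₁] [Fintype M₂] [Fintype S] :
    IsPMF (letterLaw M₁ M₂ S) := by
  refine ⟨fun γ => mul_nonneg ((isPMF_unif _).1 _)
    (mul_nonneg ((isPMF_unif _).1 _) ((isPMF_unif _).1 _)), ?_⟩
  have := sum_letterLaw (M₁ := M₁) (M₂ := M₂) (S := S) (fun _ => 1) (fun _ => 1) (fun _ => 1)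
  simpa [(isPMF_unif _).2] using this

lemma ite_prod_eq (x x' y y' : Bool) : (if (x, y) = (x', y') then (1 : ℝ) else 0) =
    (if y = y' then 1 else 0) * (if x = x' then 1 else 0) := by
  revert x x' y y'
  simp

lemma indepLetters_fst (M₁ M₂ S : Type*) {S' : Type*} [Fintype M₁] [Fintype M₂] [Fintype S]
    {e : S' → S} (he : Function.Injective e) :
    IndepLetters (letterLaw M₁ M₂ S) (fun γ => γ.1) (fun γ s => γ.2.2 (e s)) := by
  intro m m' hm κ κ' α α' β β'
  simp only [ite_prod_eq]
  have := sum_letterLaw (M₁ := M₁) (M₂ := M₂) (S := S)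
    (fun x => if Bool.xor (x m') β' = Bool.xor (x m) β then 1 else 0) (fun _ => 1)
    (fun x => if Bool.xor (x (e κ')) α' = Bool.xor (x (e κ)) α then 1 else 0)
  simp only [one_mul, sum_unif_xor_eq_ite, mul_one, (isPMF_unif _).2, hm, he.eq_iff,
    if_false] at this
  refine (le_of_eq this).trans (le_of_eq ?_)
  split_ifs <;> norm_num

lemma indepLetters_snd (M₁ M₂ S : Type*) {S' : Type*} [Fintype M₁] [Fintype M₂] [Fintype S]
    {e : S' → S} (he : Function.Injective e) :
    IndepLetters (letterLaw M₁ M₂ S) (fun γ => γ.2.1) (fun γ s => γ.2.2 (e s)) := by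
  intro m m' hm κ κ' α α' β β'
  simp only [ite_prod_eq]
  have := sum_letterLaw (M₁ := M₁) (M₂ := M₂) (S := S) (fun _ => 1)
    (fun x => if Bool.xor (x m') β' = Bool.xor (x m) β then 1 else 0)
    (fun x => if Bool.xor (x (e κ')) α' = Bool.xor (x (e κ)) α then 1 else 0)
  simp only [one_mul, sum_unif_xor_eq_ite, mul_one, (isPMF_unif _).2, hm, he.eq_iff,
    if_false] at this
  refine (le_of_eq this).trans (le_of_eq ?_)
  split_ifs <;> norm_num

/-! ### Exponents of the random coding bound -/

lemma continuousAt_likeRatio {p : Bool × Bool × Bool → ℝ} (b : Bool) (z u : Bool × Bool × Bool) :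
    ContinuousAt (fun s : ℝ => likeRatio p (1 / (1 + s)) b z u) 0 := by
  unfold likeRatio
  refine ContinuousAt.rpow continuousAt_const ?_ (Or.inr (by norm_num))
  exact continuousAt_const.div (by fun_prop) (by norm_num)

lemma eventually_freeSum_le {p : Bool × Bool × Bool → ℝ} (hp : IsPMF p) (b : Bool) {v : ℝ}
    (hv : v < 2 - entOf p (resolve b)) :
    ∀ᶠ ρ in nhdsWithin (0 : ℝ) (Set.Ioi 0),
      ∑ z, p z * freeSum p (1 / (1 + ρ)) b z ^ ρ ≤ (2 : ℝ) ^ (-(ρ * v)) := by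
  have hq : ∀ z, 0 < p z → 0 < distOf p (resolve b) (resolve b z) := fun z hz =>
    hz.trans_le (le_distOf hp.1 _ _)
  have h0 : ∀ z, freeSum p (1 / (1 + 0)) b z =
      1 / distOf p (resolve b) (resolve b z) / 4 := fun z => by
    simp only [freeSum, likeRatio, add_zero, div_one, Real.rpow_one]
    rw [← Finset.sum_div, sum_distOf, hp.2]
  refine eventually_sum_mul_rpow_le hp (fun z s => freeSum p (1 / (1 + s)) b z) ?_ ?_ ?_
  · intro z _
    unfold freeSum
    exact (tendsto_finsetSum _ fun u _ => continuousAt_likeRatio b z u).div_const 4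
  · intro z hz
    rw [h0]
    have := hq z hz
    positivity
  · have : ∀ z, p z * Real.logb 2 (freeSum p (1 / (1 + 0)) b z) =
        -(p z * Real.logb 2 (distOf p (resolve b) (resolve b z))) - 2 * p z := by
      intro z
      rcases (hp.1 z).eq_or_lt with hz | hz
      · simp [← hz]
      · have hne := (hq z hz).ne'
        rw [h0, Real.logb_div (by positivity) (by norm_num), Real.logb_div one_ne_zero hne,
          show (4 : ℝ) = 2 ^ (2 : ℝ) by norm_num, Real.logb_rpow (by norm_num) (by norm_num)]
        simp
        ring
    simp only [this, Finset.sum_sub_distrib, Finset.sum_neg_distrib, ← Finset.mul_sum, hp.2]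
    rw [entOf_eq_neg_sum] at hv
    linarith

/-- Rate supported by the private bit alone. -/
def boundExp (p : Bool × Bool × Bool → ℝ) (b : Bool) : ℝ :=
  if b then 1 else 1 - entOf p (fun z => z) + entOf p (fun z => (z.1, z.2.2))

lemma eventually_boundSum_le {p : Bool × Bool × Bool → ℝ} (hp : IsPMF p) (b : Bool) {v : ℝ}
    (hv : v < boundExp p b) :
    ∀ᶠ ρ in nhdsWithin (0 : ℝ) (Set.Ioi 0),
      ∑ z, p z * boundSum p (1 / (1 + ρ)) b z ^ ρ ≤ (2 : ℝ) ^ (-(ρ * v)) := by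
  have hq : ∀ z, 0 < p z → 0 < distOf p (resolve b) (resolve b z) := fun z hz =>
    hz.trans_le (le_distOf hp.1 _ _)
  refine eventually_sum_mul_rpow_le hp (fun z s => boundSum p (1 / (1 + s)) b z) ?_ ?_ ?_
  · intro z _
    unfold boundSum
    refine (tendsto_finsetSum _ fun u _ => ?_).div_const 2
    split_ifs
    · exact continuousAt_likeRatio b z u
    · exact tendsto_const_nhds
  · intro z hz
    unfold boundSum
    refine div_pos (Finset.sum_pos' (fun u _ => ?_) ⟨resolve b z, Finset.mem_univ _, ?_⟩)
      (by norm_num)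
    · split_ifs
      · exact likeRatio_nonneg hp _ _ _ _
      · exact le_rfl
    · rw [if_pos ⟨resolve_fst b z, pick_resolve b z⟩]
      exact Real.rpow_pos_of_pos (div_pos (hq z hz) (hq z hz)) _
  · cases b with
    | true =>
      have h0 : ∀ z, 0 < p z → boundSum p (1 / (1 + 0)) true z = 1 / 2 := by
        intro z hz
        have hz' := (hq z hz).ne'
        have hterm : ∀ u : Bool × Bool × Bool,
            (if u.1 = z.1 ∧ pick true u = pick true z then likeRatio p (1 / (1 + 0)) true z u
              else 0) = if u = resolve true z then 1 else 0 := by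
          intro u
          simp only [likeRatio, add_zero, div_one, Real.rpow_one]
          by_cases hu : u = resolve true z
          · subst hu
            rw [if_pos ⟨resolve_fst true z, pick_resolve true z⟩, if_pos rfl, div_self hz']
          · rw [if_neg hu]
            split_ifs with hc
            · have : u.2.2 = true := by
                by_contra h3
                refine hu ?_
                simp only [pick, if_true] at hc
                ext <;> simp_all [resolve]
              have : distOf p (resolve true) u = 0 := by
                rw [distOf, prOf]
                refine Finset.sum_eq_zero fun w _ => if_neg fun hw => ?_
                rw [← hw] at this
                simp [resolve] at this
              rw [this, zero_div]
            · rfl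
        unfold boundSum
        simp only [hterm]
        simp
      have : ∀ z, p z * Real.logb 2 (boundSum p (1 / (1 + 0)) true z) = -p z := by
        intro z
        rcases (hp.1 z).eq_or_lt with hz | hz
        · simp [← hz]
        · rw [h0 z hz, Real.logb_div (by norm_num) (by norm_num)]
          simp
      simp only [this, Finset.sum_neg_distrib, hp.2]
      simp only [boundExp, if_true] at hv
      linarith
    | false =>
      have hid : ∀ u, distOf p (resolve false) u = p u := fun u => distOf_id p u
      have hr : ∀ u, resolve false u = u := fun _ => rfl
      have h0 : ∀ z, boundSum p (1 / (1 + 0)) false z =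
          distOf p (fun z => (z.1, z.2.2)) (z.1, z.2.2) / p z / 2 := by
        intro z
        simp only [boundSum, likeRatio, add_zero, div_one, Real.rpow_one, hid, hr, pick]
        congr 1
        rw [distOf, prOf, Finset.sum_div]
        refine Finset.sum_congr rfl fun u _ => ?_
        simp only [Prod.mk.injEq, Bool.false_eq_true, if_false]
        split_ifs <;> simp
      have : ∀ z, p z * Real.logb 2 (boundSum p (1 / (1 + 0)) false z) =
          p z * Real.logb 2 (distOf p (fun z => (z.1, z.2.2)) (z.1, z.2.2)) -
            p z * Real.logb 2 (distOf p (fun z => z) z) - p z := by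
        intro z
        rcases (hp.1 z).eq_or_lt with hz | hz
        · simp [← hz]
        · have h3 : distOf p (fun z => (z.1, z.2.2)) (z.1, z.2.2) ≠ 0 :=
            (hz.trans_le (le_distOf hp.1 (fun z => (z.1, z.2.2)) z)).ne'
          rw [h0 z, Real.logb_div (div_ne_zero h3 hz.ne') (by norm_num),
            Real.logb_div h3 hz.ne', distOf_id]
          simp
          ring
      simp only [this, Finset.sum_sub_distrib, hp.2]
      simp only [boundExp, Bool.false_eq_true, if_false, entOf_eq_neg_sum] at hv
      linarith

/-! ### Entropy inequalities -/

/-- A two-to-one function loses at most one bit of entropy. -/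
lemma entOf_id_le_add_one {Ω A : Type*} [Fintype Ω] [Fintype A] {p : Ω → ℝ} (hp : IsPMF p)
    (X : Ω → A) (hX : ∑ z, distOf p X (X z) = 2) :
    entOf p (fun z => z) ≤ entOf p X + 1 := by
  have hl : 0 < Real.log 2 := Real.log_pos (by norm_num)
  have hterm : ∀ z, p z * Real.logb 2 (distOf p X (X z)) - p z * Real.logb 2 (distOf p (fun z => z) z)
      - p z ≤ (distOf p X (X z) / 2 - p z) / Real.log 2 := by
    intro z
    rcases (hp.1 z).eq_or_lt with hz | hz
    · simp only [← hz, zero_mul, sub_zero]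
      exact div_nonneg (div_nonneg (distOf_nonneg hp.1 _ _) (by norm_num)) hl.le
    · have hd := hz.trans_le (le_distOf hp.1 X z)
      rw [distOf_id]
      have h1 := Real.log_le_sub_one_of_pos (show 0 < distOf p X (X z) / (2 * p z) by positivity)
      rw [Real.log_div hd.ne' (by positivity), Real.log_mul (by norm_num) hz.ne'] at h1
      rw [le_div_iff₀ hl]
      have h2 : (p z * Real.logb 2 (distOf p X (X z)) - p z * Real.logb 2 (p z) - p z) *
          Real.log 2 = p z * (Real.log (distOf p X (X z)) - (Real.log 2 + Real.log (p z))) := by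
        simp only [Real.logb]
        field_simp
        ring
      rw [h2]
      refine (mul_le_mul_of_nonneg_left h1 hz.le).trans (le_of_eq ?_)
      field_simp
  have hsum := Finset.sum_le_sum fun z (_ : z ∈ Finset.univ) => hterm z
  rw [← Finset.sum_div, Finset.sum_sub_distrib, Finset.sum_sub_distrib, Finset.sum_sub_distrib,
    ← Finset.sum_div, hX, hp.2] at hsum
  simp only [entOf_eq_neg_sum]
  norm_num at hsum
  linarith

/-- The law of the noise with the two private noise bits exchanged. -/
def swapLaw (p : Bool × Bool × Bool → ℝ) : Bool × Bool × Bool → ℝ :=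
  fun z => p (z.1, z.2.2, z.2.1)

/-- Exchange of the two private noise bits. -/
def swapEquiv : Bool × Bool × Bool ≃ Bool × Bool × Bool where
  toFun z := (z.1, z.2.2, z.2.1)
  invFun z := (z.1, z.2.2, z.2.1)
  left_inv _ := rfl
  right_inv _ := rfl

lemma isPMF_swapLaw {p : Bool × Bool × Bool → ℝ} (hp : IsPMF p) : IsPMF (swapLaw p) :=
  ⟨fun _ => hp.1 _, (swapEquiv.sum_comp p).trans hp.2⟩

lemma entOf_swapLaw {A : Type*} [Fintype A] (p : Bool × Bool × Bool → ℝ)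
    (X : Bool × Bool × Bool → A) : entOf (swapLaw p) X = entOf p fun z => X (swapEquiv z) := by
  have : distOf (swapLaw p) X = distOf p fun z => X (swapEquiv z) := by
    funext a
    exact Equiv.sum_comp swapEquiv (fun z => if X (swapEquiv z) = a then p z else 0)
  rw [entOf, entOf, this]

lemma entOf_comp_injective {Ω A B : Type*} [Fintype Ω] [Fintype A] [Fintype B] (p : Ω → ℝ)
    (X : Ω → A) {g : A → B} (hg : Function.Injective g) :
    entOf p (fun z => g (X z)) = entOf p X := by
  simp only [entOf_eq_neg_sum, distOf, prOf, hg.eq_iff]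

lemma entOf_resolve_true (p : Bool × Bool × Bool → ℝ) :
    entOf p (resolve true) = entOf p fun z => (z.1, z.2.1) :=
  entOf_comp_injective p (fun z => (z.1, z.2.1))
    (g := fun a : Bool × Bool => (a.1, a.2, false)) fun a b h => by
      simp only [Prod.mk.injEq, and_true] at h
      exact Prod.ext h.1 h.2

lemma entOf_resolve_false (p : Bool × Bool × Bool → ℝ) :
    entOf p (resolve false) = entOf p fun z => z := rfl

lemma entOf_swapLaw_id (p : Bool × Bool × Bool → ℝ) :
    entOf (swapLaw p) (fun z => z) = entOf p fun z => z := by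
  rw [entOf_swapLaw]
  exact entOf_comp_injective p (fun z => z) swapEquiv.injective

lemma entOf_id_le_fst_add_one {p : Bool × Bool × Bool → ℝ} (hp : IsPMF p) :
    entOf p (fun z => z) ≤ entOf p (fun z => (z.1, z.2.1)) + 1 := by
  refine entOf_id_le_add_one hp _ ?_
  have h := sum_distOf p fun z => (z.1, z.2.1)
  rw [hp.2] at h
  simp only [Fintype.sum_prod_type, Fintype.sum_bool] at h ⊢
  linarith

lemma entOf_id_le_snd_add_one {p : Bool × Bool × Bool → ℝ} (hp : IsPMF p) :
    entOf p (fun z => z) ≤ entOf p (fun z => (z.1, z.2.2)) + 1 := by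
  have := entOf_id_le_fst_add_one (isPMF_swapLaw hp)
  rwa [entOf_swapLaw_id, entOf_swapLaw] at this

/-! ### The feedback code attached to a codebook -/

section Code

variable {K₁ L₁ K₂ L₂ : Type*} {n : ℕ}

/-- The letters of the random codebook for blocklength `n`. -/
abbrev BookLetter (K₁ L₁ K₂ L₂ : Type*) (n : ℕ) :=
  Letter (K₁ × L₁) (K₂ × L₂) ((K₁ × K₂) × (Fin n → Bool))

/-- The private bit of the first receiver. -/
def privBit₁ (γ : BookLetter K₁ L₁ K₂ L₂ n) (m : K₁ × L₁) : Bool := γ.1 m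

/-- The private bit of the second receiver. -/
def privBit₂ (γ : BookLetter K₁ L₁ K₂ L₂ n) (m : K₂ × L₂) : Bool := γ.2.1 m

/-- The common bit, as indexed by the first receiver. -/
def commonBit₁ (γ : BookLetter K₁ L₁ K₂ L₂ n) (s : (K₁ × K₂) × (Fin n → Bool)) : Bool := γ.2.2 s

/-- The common bit, as indexed by the second receiver. -/
def commonBit₂ (γ : BookLetter K₁ L₁ K₂ L₂ n) (s : (K₂ × K₁) × (Fin n → Bool)) : Bool :=
  γ.2.2 ((s.1.2, s.1.1), s.2)

/-- The channel input at time `t` when the noise bits to be forwarded are `w`. -/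
def bookInput (γ : Fin n → BookLetter K₁ L₁ K₂ L₂ n) (m₁ : K₁ × L₁) (m₂ : K₂ × L₂)
    (w : Fin n → Bool) (t : Fin n) : Bool × Bool × Bool :=
  (privBit₁ (γ t) m₁, commonBit₁ (γ t) ((m₁.1, m₂.1), before t w), privBit₂ (γ t) m₂)

/-- The noise bits to be forwarded, computed from the feedback. -/
def fedBack (A : Fin n → Bool) (γ : Fin n → BookLetter K₁ L₁ K₂ L₂ n) (m₁ : K₁ × L₁)
    (m₂ : K₂ × L₂) (fb : Fin n → (Bool × Bool) × Bool × Bool) (s : Fin n) : Bool :=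
  if A s then Bool.xor (privBit₁ (γ s) m₁) (fb s).1.1
  else Bool.xor (privBit₂ (γ s) m₂) (fb s).2.2

/-- The output sequence produced by the noise sequence `z`. -/
def bookOutput (A : Fin n → Bool) (γ : Fin n → BookLetter K₁ L₁ K₂ L₂ n) (m₁ : K₁ × L₁)
    (m₂ : K₂ × L₂) (z : Fin n → Bool × Bool × Bool) (t : Fin n) : Bool × Bool × Bool :=
  noiseOf (bookInput γ m₁ m₂ (pickSeq A z) t) (z t)

lemma noiseOf_noiseOf (x v : Bool × Bool × Bool) : noiseOf x (noiseOf x v) = v :=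
  (noiseEquiv x).left_inv v

lemma fedBack_bookOutput (A : Fin n → Bool) (γ : Fin n → BookLetter K₁ L₁ K₂ L₂ n)
    (m₁ : K₁ × L₁) (m₂ : K₂ × L₂) (z : Fin n → Bool × Bool × Bool) :
    fedBack A γ m₁ m₂ (fun s => outPair (bookOutput A γ m₁ m₂ z s)) = pickSeq A z := by
  funext s
  cases hs : A s <;> simp [fedBack, outPair, bookOutput, noiseOf, bookInput, pickSeq, pick, hs]

lemma sum_bookOutput (p : Bool × Bool × Bool → ℝ) (A : Fin n → Bool)
    (γ : Fin n → BookLetter K₁ L₁ K₂ L₂ n) (m₁ : K₁ × L₁) (m₂ : K₂ × L₂)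
    (F : (Fin n → Bool × Bool × Bool) → ℝ) :
    ∑ v : Fin n → Bool × Bool × Bool, (∏ t, p (noiseOf
        (bookInput γ m₁ m₂ (fedBack A γ m₁ m₂ fun s => outPair (v s)) t) (v t))) * F v =
      ∑ z : Fin n → Bool × Bool × Bool, (∏ t, p (z t)) * F (bookOutput A γ m₁ m₂ z) := by
  have hinv : ∀ z t, noiseOf (bookInput γ m₁ m₂ (fedBack A γ m₁ m₂ fun s =>
      outPair (bookOutput A γ m₁ m₂ z s)) t) (bookOutput A γ m₁ m₂ z t) = z t := by
    intro z t
    rw [fedBack_bookOutput]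
    exact noiseOf_noiseOf _ _
  have hinj : Function.Injective (bookOutput A γ m₁ m₂) := by
    intro z z' h
    funext t
    rw [← hinv z t, ← hinv z' t, h]
  refine Eq.symm (Fintype.sum_bijective _ (Finite.injective_iff_bijective.1 hinj) _ _ fun z => ?_)
  simp only [hinv]

lemma bookOutput_eq_received₁ (A : Fin n → Bool) (γ : Fin n → BookLetter K₁ L₁ K₂ L₂ n)
    (m₁ : K₁ × L₁) (m₂ : K₂ × L₂) (z : Fin n → Bool × Bool × Bool) (t : Fin n) :
    ((bookOutput A γ m₁ m₂ z t).1, (bookOutput A γ m₁ m₂ z t).2.1) =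
      received privBit₁ commonBit₁ A γ m₁ m₂.1 z t := rfl

lemma bookOutput_eq_received₂ (A : Fin n → Bool) (γ : Fin n → BookLetter K₁ L₁ K₂ L₂ n)
    (m₁ : K₁ × L₁) (m₂ : K₂ × L₂) (z : Fin n → Bool × Bool × Bool) (t : Fin n) :
    ((bookOutput A γ m₁ m₂ z t).1, (bookOutput A γ m₁ m₂ z t).2.2) =
      received privBit₂ commonBit₂ (fun s => !A s) γ m₂ m₁.1 (fun s => swapEquiv (z s)) t := by
  have : pickSeq (fun s => !A s) (fun s => swapEquiv (z s)) = pickSeq A z := by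
    funext s
    cases hs : A s <;> simp [pickSeq, pick, swapEquiv, hs]
  unfold received
  rw [this]
  rfl

variable [Nonempty (K₁ × L₁)] [Nonempty (K₂ × L₂)]

/-- Error probability of the first receiver for given codebook and messages. -/
def bookErr₁ (p : Bool × Bool × Bool → ℝ) (A : Fin n → Bool)
    (γ : Fin n → BookLetter K₁ L₁ K₂ L₂ n) (m₁ : K₁ × L₁) (k₂ : K₂) : ℝ :=
  ∑ z : Fin n → Bool × Bool × Bool, (∏ t, p (z t)) *
    (if bestDec privBit₁ commonBit₁ A (fun b => distOf p (resolve b)) γ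
        (received privBit₁ commonBit₁ A γ m₁ k₂ z) ≠ m₁ then 1 else 0)

/-- Error probability of the second receiver for given codebook and messages. -/
def bookErr₂ (p : Bool × Bool × Bool → ℝ) (A : Fin n → Bool)
    (γ : Fin n → BookLetter K₁ L₁ K₂ L₂ n) (m₂ : K₂ × L₂) (k₁ : K₁) : ℝ :=
  ∑ z : Fin n → Bool × Bool × Bool, (∏ t, swapLaw p (z t)) *
    (if bestDec privBit₂ commonBit₂ (fun s => !A s) (fun b => distOf (swapLaw p) (resolve b)) γ
        (received privBit₂ commonBit₂ (fun s => !A s) γ m₂ k₁ z) ≠ m₂ then 1 else 0)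

lemma sum_bookOutput_err_le {p : Bool × Bool × Bool → ℝ} (hp : IsPMF p) (A : Fin n → Bool)
    (γ : Fin n → BookLetter K₁ L₁ K₂ L₂ n) (m₁ : K₁ × L₁) (m₂ : K₂ × L₂) :
    ∑ z : Fin n → Bool × Bool × Bool, (∏ t, p (z t)) *
      (if bestDec privBit₁ commonBit₁ A (fun b => distOf p (resolve b)) γ
            (fun t => ((bookOutput A γ m₁ m₂ z t).1, (bookOutput A γ m₁ m₂ z t).2.1)) ≠ m₁ ∨
          bestDec privBit₂ commonBit₂ (fun s => !A s)
            (fun b => distOf (swapLaw p) (resolve b)) γ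
            (fun t => ((bookOutput A γ m₁ m₂ z t).1, (bookOutput A γ m₁ m₂ z t).2.2)) ≠ m₂
        then 1 else 0) ≤ bookErr₁ p A γ m₁ m₂.1 + bookErr₂ p A γ m₂ m₁.1 := by
  have h2 : bookErr₂ p A γ m₂ m₁.1 = ∑ z : Fin n → Bool × Bool × Bool, (∏ t, p (z t)) *
      (if bestDec privBit₂ commonBit₂ (fun s => !A s) (fun b => distOf (swapLaw p) (resolve b)) γ
        (received privBit₂ commonBit₂ (fun s => !A s) γ m₂ m₁.1 fun s => swapEquiv (z s)) ≠ m₂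
        then 1 else 0) := by
    refine (Equiv.sum_comp (Equiv.piCongrRight fun _ : Fin n => swapEquiv) _).symm.trans ?_
    rfl
  rw [h2, bookErr₁, ← Finset.sum_add_distrib]
  refine Finset.sum_le_sum fun z _ => ?_
  rw [← mul_add]
  refine mul_le_mul_of_nonneg_left ?_ (Finset.prod_nonneg fun t _ => hp.1 _)
  simp only [bookOutput_eq_received₁, bookOutput_eq_received₂]
  by_cases ha : bestDec privBit₁ commonBit₁ A (fun b => distOf p (resolve b)) γ
        (received privBit₁ commonBit₁ A γ m₁ m₂.1 z) = m₁ <;>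
  by_cases hb : bestDec privBit₂ commonBit₂ (fun s => !A s)
        (fun b => distOf (swapLaw p) (resolve b)) γ
        (received privBit₂ commonBit₂ (fun s => !A s) γ m₂ m₁.1 fun s => swapEquiv (z s)) = m₂ <;>
  simp [ha, hb]

end Code

/-- A codebook yields a feedback code without common message. -/
lemma exists_code {K₁ L₁ K₂ L₂ : Type*} [Nonempty (K₁ × L₁)] [Nonempty (K₂ × L₂)] {n : ℕ}
    {PZ : Bool × Bool × Bool → ℝ} (hPZ : IsPMF PZ) {R₁ R₂ : ℝ} (hR₁ : 0 ≤ R₁) (hR₂ : 0 ≤ R₂)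
    (ι₁ : Fin (msgCard n R₁) ↪ K₁ × L₁) (ι₂ : Fin (msgCard n R₂) ↪ K₂ × L₂)
    (A : Fin n → Bool) (γ : Fin n → BookLetter K₁ L₁ K₂ L₂ n) :
    ∃ enc : Fin n → Fin (msgCard n 0) × Fin (msgCard n R₁) × Fin (msgCard n R₂) →
        (Fin n → (Bool × Bool) × Bool × Bool) → Bool × Bool × Bool,
    ∃ dec1 : (Fin n → Bool × Bool) → Fin (msgCard n 0) × Fin (msgCard n R₁),
    ∃ dec2 : (Fin n → Bool × Bool) → Fin (msgCard n 0) × Fin (msgCard n R₂),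
      Causal n enc ∧ errProbFB (noiselessExt (dueckW PZ)) n 0 R₁ R₂ enc dec1 dec2 ≤
        ∑ m, unif (Fin (msgCard n 0) × Fin (msgCard n R₁) × Fin (msgCard n R₂)) m *
          (bookErr₁ PZ A γ (ι₁ m.2.1) (ι₂ m.2.2).1 + bookErr₂ PZ A γ (ι₂ m.2.2) (ι₁ m.2.1).1) := by
  have : Nonempty (Fin (msgCard n R₁)) := ⟨⟨0, msgCard_pos n hR₁⟩⟩
  have : Nonempty (Fin (msgCard n R₂)) := ⟨⟨0, msgCard_pos n hR₂⟩⟩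
  have h0 : msgCard n 0 = 1 := by simp [msgCard]
  have : Subsingleton (Fin (msgCard n 0)) := by rw [h0]; infer_instance
  let o : Fin (msgCard n 0) := ⟨0, by rw [h0]; norm_num⟩
  refine ⟨fun t m fb => bookInput γ (ι₁ m.2.1) (ι₂ m.2.2) (fedBack A γ (ι₁ m.2.1) (ι₂ m.2.2) fb) t,
    fun y => (o, Function.invFun ι₁ (bestDec privBit₁ commonBit₁ A
      (fun b => distOf PZ (resolve b)) γ fun t => ((y t).2, (y t).1))),
    fun y => (o, Function.invFun ι₂ (bestDec privBit₂ commonBit₂ (fun s => !A s)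
      (fun b => distOf (swapLaw PZ) (resolve b)) γ y)), ?_, ?_⟩
  · intro t m fb fb' h
    simp only [bookInput]
    rw [(before_eq_iff t _ _).2 fun s hs => ?_]
    simp only [fedBack, h s hs]
  · rw [errProbFB_dueck, Finset.mul_sum]
    refine Finset.sum_le_sum fun m _ => ?_
    have hc : unif (Fin (msgCard n 0) × Fin (msgCard n R₁) × Fin (msgCard n R₂)) m =
        1 / ((msgCard n 0 : ℝ) * (msgCard n R₁ : ℝ) * (msgCard n R₂ : ℝ)) := by
      simp [unif, mul_assoc]
    rw [hc]
    refine mul_le_mul_of_nonneg_left ?_ (by positivity)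
    rw [sum_bookOutput]
    refine le_trans (Finset.sum_le_sum fun z _ => ?_)
      (sum_bookOutput_err_le hPZ A γ (ι₁ m.2.1) (ι₂ m.2.2))
    refine mul_le_mul_of_nonneg_left ?_ (Finset.prod_nonneg fun t _ => hPZ.1 _)
    split_ifs with ha hb
    · exact le_rfl
    · exfalso
      push Not at hb
      rcases ha with ha | ha
      · refine ha (Prod.ext (Subsingleton.elim _ _) ?_)
        simp only
        rw [hb.1, Function.leftInverse_invFun ι₁.injective]
      · refine ha (Prod.ext (Subsingleton.elim _ _) ?_)
        simp only
        rw [hb.2, Function.leftInverse_invFun ι₂.injective]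
    · exact zero_le_one
    · exact le_rfl

lemma sum_mul_sum_mul_le_of_forall {Γ M : Type*} [Fintype Γ] [Fintype M] {W : Γ → ℝ} {μ : M → ℝ}
    (hμ : IsPMF μ) {f : Γ → M → ℝ} {B : ℝ} (h : ∀ m, ∑ γ, W γ * f γ m ≤ B) :
    ∑ γ, W γ * ∑ m, μ m * f γ m ≤ B := by
  calc ∑ γ, W γ * ∑ m, μ m * f γ m = ∑ m, μ m * ∑ γ, W γ * f γ m := by
        simp only [Finset.mul_sum]
        rw [Finset.sum_comm]
        refine Finset.sum_congr rfl fun m _ => Finset.sum_congr rfl fun γ _ => ?_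
        ring
    _ ≤ ∑ m, μ m * B := Finset.sum_le_sum fun m _ => mul_le_mul_of_nonneg_left (h m) (hμ.1 m)
    _ = B := by rw [← Finset.sum_mul, hμ.2, one_mul]

/-! ### Exponential decay of the average error -/

lemma prod_two_rpow_le {n : ℕ} {A : Fin n → Bool} {l : ℝ}
    (hA : |((Finset.univ.filter fun t => A t = true).card : ℝ) - l * n| ≤ 1) {ρ : ℝ} (hρ : 0 ≤ ρ)
    (v : Bool → ℝ) :
    ∏ t, (2 : ℝ) ^ (-(ρ * v (A t))) ≤
      2 ^ (ρ * (|v true - v false| - n * (l * v true + (1 - l) * v false))) := by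
  have hsum : ∑ t, v (A t) =
      n * v false + (Finset.univ.filter fun t => A t = true).card * (v true - v false) := by
    have h1 : ∀ t, v (A t) = v false + if A t = true then v true - v false else 0 := fun t => by
      cases A t <;> simp
    simp only [h1, Finset.sum_add_distrib]
    rw [← Finset.sum_filter]
    simp
    ring
  rw [← Real.rpow_sum_of_pos (by norm_num), Finset.sum_neg_distrib, ← Finset.mul_sum, hsum,
    ← mul_neg]
  refine Real.rpow_le_rpow_of_exponent_le (by norm_num) (mul_le_mul_of_nonneg_left ?_ hρ)
  have h2 := neg_abs_le
    ((((Finset.univ.filter fun t => A t = true).card : ℝ) - l * n) * (v true - v false))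
  rw [abs_mul] at h2
  have h3 := mul_le_mul_of_nonneg_right hA (abs_nonneg (v true - v false))
  nlinarith

lemma tendsto_succ_mul_two_rpow_neg {a : ℝ} (ha : 0 < a) :
    Filter.Tendsto (fun n : ℕ => ((n : ℝ) + 1) * (2 : ℝ) ^ (-((n : ℝ) * a))) Filter.atTop
      (nhds 0) := by
  have hlt : (2 : ℝ) ^ (-a) < 1 := Real.rpow_lt_one_of_one_lt_of_neg (by norm_num) (by linarith)
  have h := (tendsto_self_mul_const_pow_of_lt_one (Real.rpow_pos_of_pos two_pos _).le hlt).add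
    (tendsto_two_rpow_neg_mul ha)
  rw [add_zero] at h
  refine h.congr fun n => ?_
  have : ((2 : ℝ) ^ (-a)) ^ n = 2 ^ (-((n : ℝ) * a)) := by
    rw [← Real.rpow_natCast, ← Real.rpow_mul (by norm_num)]
    ring_nf
  rw [this]
  ring

/-- The error of a receiver decoding `λ`-timeshared forwarded noise vanishes below the
mutual-information thresholds. -/
lemma exists_vanishing_bound {p : Bool × Bool × Bool → ℝ} (hp : IsPMF p)
    (h1 : entOf p (fun z => (z.1, z.2.1)) ≤ 1) (h2 : entOf p (fun z => (z.1, z.2.2)) ≤ 1)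
    {l r r' : ℝ}
    (hr : r < l * (2 - entOf p fun z => (z.1, z.2.1)) + (1 - l) * (2 - entOf p fun z => z))
    (hr' : r' < l + (1 - l) * (1 - entOf p (fun z => z) + entOf p fun z => (z.1, z.2.2))) :
    ∃ B : ℕ → ℝ, Filter.Tendsto B Filter.atTop (nhds 0) ∧
      ∀ (n : ℕ) (K K' L Γ : Type) [Fintype Γ] [Fintype K] [Fintype K'] [Fintype L] [Nonempty K]
        [Nonempty K'] [Nonempty L] (W : Γ → ℝ) (_ : IsPMF W) (c : Γ → K × L → Bool)
        (h : Γ → (K × K') × (Fin n → Bool) → Bool) (_ : IndepLetters W c h) (A : Fin n → Bool)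
        (m : K × L) (k : K'),
        |((Finset.univ.filter fun t => A t = true).card : ℝ) - l * n| ≤ 1 →
        ((Fintype.card K : ℝ) * Fintype.card K' - 1) * Fintype.card L ≤ 8 * 2 ^ (n * r) →
        (Fintype.card L : ℝ) - 1 ≤ 8 * 2 ^ (n * r') →
        ∑ γ : Fin n → Γ, (∏ t, W (γ t)) * ∑ z : Fin n → Bool × Bool × Bool, (∏ t, p (z t)) *
          (if bestDec c h A (fun b => distOf p (resolve b)) γ (received c h A γ m k z) ≠ m
            then 1 else 0) ≤ B n := by
  set a := entOf p (fun z => (z.1, z.2.1)) with ha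
  set b := entOf p (fun z => (z.1, z.2.2)) with hb
  set H := entOf p (fun z => z) with hH
  obtain ⟨δ, hδ, hδr⟩ : ∃ δ > 0, r + 2 * δ = l * (2 - a) + (1 - l) * (2 - H) :=
    ⟨(l * (2 - a) + (1 - l) * (2 - H) - r) / 2, by linarith, by ring⟩
  obtain ⟨δ', hδ', hδr'⟩ : ∃ δ' > 0, r' + 2 * δ' = l + (1 - l) * (1 - H + b) :=
    ⟨(l + (1 - l) * (1 - H + b) - r') / 2, by linarith, by ring⟩
  let v : Bool → ℝ := fun x => (if x then 2 - a else 2 - H) - δ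
  let g : Bool → ℝ := fun x => (if x then 1 else 1 - H + b) - δ'
  have hent : ∀ x, entOf p (resolve x) = if x then a else H := by
    intro x
    cases x
    · exact entOf_resolve_false p
    · exact entOf_resolve_true p
  have hv : ∀ x, v x < 2 - entOf p (resolve x) := by
    intro x
    rw [hent]
    cases x <;> simp [v, hδ]
  have hg : ∀ x, g x < 2 - entOf p (resolve x) := by
    intro x
    rw [hent]
    cases x <;> simp [g] <;> linarith
  have hg' : ∀ x, g x < boundExp p x := by
    intro x
    cases x <;> simp [g, boundExp, hδ', ← hb, ← hH]
  have hev : ∀ᶠ ρ in nhdsWithin (0 : ℝ) (Set.Ioi 0), (0 < ρ ∧ ρ ≤ 1) ∧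
      (∀ x, ∑ z, p z * freeSum p (1 / (1 + ρ)) x z ^ ρ ≤ 2 ^ (-(ρ * v x))) ∧
      (∀ x, ∑ z, p z * freeSum p (1 / (1 + ρ)) x z ^ ρ ≤ 2 ^ (-(ρ * g x))) ∧
      ∀ x, ∑ z, p z * boundSum p (1 / (1 + ρ)) x z ^ ρ ≤ 2 ^ (-(ρ * g x)) := by
    refine Filter.Eventually.and ?_ (Filter.Eventually.and ?_ (Filter.Eventually.and ?_ ?_))
    · filter_upwards [Ioc_mem_nhdsGT (show (0 : ℝ) < 1 by norm_num)] with ρ hρ using hρ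
    · exact Filter.eventually_all.2 fun x => eventually_freeSum_le hp x (hv x)
    · exact Filter.eventually_all.2 fun x => eventually_freeSum_le hp x (hg x)
    · exact Filter.eventually_all.2 fun x => eventually_boundSum_le hp x (hg' x)
  obtain ⟨ρ, ⟨hρ, hρ1⟩, hF, hFκ, hGκ⟩ := hev.exists
  let C : ℝ := 8 ^ ρ * 2 ^ (ρ * |v true - v false|)
  let C' : ℝ := 2 * (8 ^ ρ * 2 ^ (ρ * |g true - g false|))
  refine ⟨fun n => C * 2 ^ (-((n : ℝ) * (ρ * δ))) +
    C' * (((n : ℝ) + 1) * 2 ^ (-((n : ℝ) * (ρ * δ')))), ?_, ?_⟩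
  · simpa using ((tendsto_two_rpow_neg_mul (mul_pos hρ hδ)).const_mul C).add
      ((tendsto_succ_mul_two_rpow_neg (mul_pos hρ hδ')).const_mul C')
  · intro n K K' L Γ _ _ _ _ _ _ _ W hW c h hind A m k hA hN hN'
    refine (sum_codebook_noise_err_le hW hind hp A m k (by positivity) hρ hρ1 hF hFκ hGκ).trans ?_
    have hL : (1 : ℝ) ≤ Fintype.card L := by exact_mod_cast Fintype.card_pos
    have hK : (1 : ℝ) ≤ Fintype.card K := by exact_mod_cast Fintype.card_pos
    have hK' : (1 : ℝ) ≤ Fintype.card K' := by exact_mod_cast Fintype.card_pos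
    have hpow : ∀ (s x : ℝ) (w : Bool → ℝ), 0 ≤ x → x ≤ 8 * 2 ^ (n * s) →
        x ^ ρ * ∏ t, (2 : ℝ) ^ (-(ρ * w (A t))) ≤ 8 ^ ρ * 2 ^ (ρ * |w true - w false|) *
          2 ^ ((n : ℝ) * (ρ * (s - (l * w true + (1 - l) * w false)))) := by
      intro s x w hx hxs
      refine (mul_le_mul (Real.rpow_le_rpow hx hxs hρ.le) (prod_two_rpow_le hA hρ.le w)
        (Finset.prod_nonneg fun t _ => by positivity) (by positivity)).trans (le_of_eq ?_)
      rw [Real.mul_rpow (by norm_num) (by positivity), ← Real.rpow_mul (by norm_num), mul_assoc,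
        mul_assoc ((8 : ℝ) ^ ρ), ← Real.rpow_add (by norm_num), ← Real.rpow_add (by norm_num)]
      ring_nf
    refine add_le_add ?_ ?_
    · refine (hpow r _ v ?_ hN).trans (le_of_eq ?_)
      · exact mul_nonneg (by nlinarith) (by linarith)
      · have : r - (l * v true + (1 - l) * v false) = -δ := by
          simp only [v, if_true, Bool.false_eq_true, if_false]
          linarith
        rw [this]
        simp only [C, mul_neg]
    · have h3 := hpow r' _ g (by linarith) hN'
      have : r' - (l * g true + (1 - l) * g false) = -δ' := by
        simp only [g, if_true, Bool.false_eq_true, if_false]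
        linarith
      rw [this] at h3
      have h4 := mul_le_mul_of_nonneg_left h3 (show (0 : ℝ) ≤ 2 * (n + 1) by positivity)
      refine (le_of_eq ?_).trans (h4.trans (le_of_eq ?_))
      · ring
      · simp only [C', mul_neg]
        ring

/-! ### Splitting the rates -/

/-- Rate splitting: `d` is the rate of the forwarded part, `e` of the private part. -/
lemma exists_rate_split {a b H r₁ r₂ : ℝ} (ha : a ≤ 1) (hb : b ≤ 1) (hHa : H ≤ a + 1) (hHb : H ≤ b + 1) (h₁ : 0 ≤ r₁) (h₂ : 0 ≤ r₂) (hr₁ : r₁ ≤ 2 - a)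
    (hr₂ : r₂ ≤ 2 - b) (hr : r₁ + r₂ ≤ 3 - H) :
    ∃ l d₁ d₂ e₁ e₂ : ℝ, 0 ≤ l ∧ l ≤ 1 ∧ 0 ≤ d₁ ∧ 0 ≤ d₂ ∧ 0 ≤ e₁ ∧ 0 ≤ e₂ ∧
      d₁ + e₁ = r₁ ∧ d₂ + e₂ = r₂ ∧ e₁ ≤ l + (1 - l) * (1 - H + b) ∧
      e₂ ≤ (1 - l) + l * (1 - H + a) ∧
      d₁ + d₂ ≤ l * (1 - a) + (1 - l) * (1 - b) := by
  obtain ⟨l, hl0, hl1, hla, hlb⟩ : ∃ l : ℝ, 0 ≤ l ∧ l ≤ 1 ∧ r₁ ≤ 2 - H + l * (H - a) ∧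
      r₂ ≤ 2 - b - l * (H - b) := by
    by_cases h0 : r₁ ≤ 2 - H
    · exact ⟨0, le_rfl, zero_le_one, by linarith, by linarith⟩
    · push Not at h0
      have hpos : 0 < H - a := by linarith
      have hmul : (r₁ - 2 + H) / (H - a) * (H - a) = r₁ - 2 + H := div_mul_cancel₀ _ hpos.ne'
      have hl0 : 0 ≤ (r₁ - 2 + H) / (H - a) := div_nonneg (by linarith) hpos.le
      have hl1 : (r₁ - 2 + H) / (H - a) ≤ 1 := (div_le_one hpos).2 (by linarith)
      refine ⟨(r₁ - 2 + H) / (H - a), hl0, hl1, by linarith, ?_⟩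
      generalize (r₁ - 2 + H) / (H - a) = l at *
      nlinarith [mul_nonneg hl0 (sub_nonneg.2 ha),
        mul_nonneg (sub_nonneg.2 hl1) (sub_nonneg.2 hb)]
  set E₁ := l + (1 - l) * (1 - H + b) with hE₁
  set E₂ := (1 - l) + l * (1 - H + a) with hE₂
  have hE₁0 : 0 ≤ E₁ := by
    have := mul_nonneg (sub_nonneg.2 hl1) (show 0 ≤ 1 - H + b by linarith)
    linarith
  have hE₂0 : 0 ≤ E₂ := by
    have := mul_nonneg hl0 (show 0 ≤ 1 - H + a by linarith)
    linarith
  refine ⟨l, r₁ - min r₁ E₁, r₂ - min r₂ E₂, min r₁ E₁, min r₂ E₂, hl0, hl1,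
    sub_nonneg.2 (min_le_left _ _), sub_nonneg.2 (min_le_left _ _), le_min h₁ hE₁0,
    le_min h₂ hE₂0, by ring, by ring, min_le_right _ _, min_le_right _ _, ?_⟩
  have hD : 0 ≤ l * (1 - a) + (1 - l) * (1 - b) :=
    add_nonneg (mul_nonneg hl0 (by linarith)) (mul_nonneg (by linarith) (by linarith))
  rcases le_total r₁ E₁ with h | h <;> rcases le_total r₂ E₂ with h' | h' <;>
    simp only [min_eq_left, min_eq_right, h, h'] <;> nlinarith

/-- The least number of messages of rate at least `s`. -/
def ceilCard (n : ℕ) (s : ℝ) : ℕ := ⌈(2 : ℝ) ^ ((n : ℝ) * s)⌉₊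

lemma ceilCard_pos (n : ℕ) (s : ℝ) : 0 < ceilCard n s := Nat.ceil_pos.2 (by positivity)

lemma le_ceilCard (n : ℕ) (s : ℝ) : (2 : ℝ) ^ ((n : ℝ) * s) ≤ ceilCard n s := Nat.le_ceil _

lemma ceilCard_zero (n : ℕ) : ceilCard n 0 = 1 := by simp [ceilCard]

lemma ceilCard_le (n : ℕ) {s : ℝ} (hs : 0 ≤ s) :
    (ceilCard n s : ℝ) ≤ 2 * 2 ^ ((n : ℝ) * s) := by
  have h1 := (Nat.ceil_lt_add_one (show (0 : ℝ) ≤ 2 ^ ((n : ℝ) * s) by positivity)).le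
  have h2 : (1 : ℝ) ≤ 2 ^ ((n : ℝ) * s) := Real.one_le_rpow (by norm_num) (by positivity)
  unfold ceilCard
  linarith

lemma msgCard_le_ceilCard_mul (n : ℕ) (d e : ℝ) :
    msgCard n (d + e) ≤ ceilCard n d * ceilCard n e := by
  refine Nat.floor_le_of_le ?_
  push_cast
  rw [mul_add, Real.rpow_add (by norm_num)]
  exact mul_le_mul (le_ceilCard n d) (le_ceilCard n e) (by positivity) (by positivity)

lemma exists_private_exponent {s e E : ℝ} (hs0 : 0 ≤ s) (hs1 : s < 1) (he : 0 ≤ e) (heE : e ≤ E) :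
    ∃ r < E, ∀ n : ℕ, (ceilCard n (s * e) : ℝ) - 1 ≤ 8 * 2 ^ ((n : ℝ) * r) := by
  rcases he.eq_or_lt with h | h
  · refine ⟨E - 1, by linarith, fun n => ?_⟩
    rw [← h, mul_zero, ceilCard_zero]
    norm_num
    positivity
  · refine ⟨s * e, by nlinarith, fun n => ?_⟩
    have := ceilCard_le n (mul_nonneg hs0 he)
    have h2 : (0 : ℝ) ≤ 2 ^ ((n : ℝ) * (s * e)) := by positivity
    linarith

lemma exists_joint_exponent {s d d' e V : ℝ} (hs0 : 0 ≤ s) (hs1 : s < 1) (hd : 0 ≤ d)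
    (hd' : 0 ≤ d') (he : 0 ≤ e) (hV : d + d' + e ≤ V) :
    ∃ r < V, ∀ n : ℕ, ((ceilCard n (s * d) : ℝ) * ceilCard n (s * d') - 1) * ceilCard n (s * e) ≤
      8 * 2 ^ ((n : ℝ) * r) := by
  by_cases h : d = 0 ∧ d' = 0
  · refine ⟨V - 1, by linarith, fun n => ?_⟩
    rw [h.1, h.2, mul_zero, ceilCard_zero]
    norm_num
    positivity
  · have hpos : 0 < d + d' := by
      by_contra hcon
      exact h ⟨by linarith, by linarith⟩
    refine ⟨s * (d + d' + e), by nlinarith, fun n => ?_⟩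
    have h1 := ceilCard_le n (mul_nonneg hs0 hd)
    have h2 := ceilCard_le n (mul_nonneg hs0 hd')
    have h3 := ceilCard_le n (mul_nonneg hs0 he)
    have h4 : (ceilCard n (s * d) : ℝ) * ceilCard n (s * d') * ceilCard n (s * e) ≤
        2 * 2 ^ ((n : ℝ) * (s * d)) * (2 * 2 ^ ((n : ℝ) * (s * d'))) *
          (2 * 2 ^ ((n : ℝ) * (s * e))) := by gcongr
    have h5 : (2 : ℝ) ^ ((n : ℝ) * (s * (d + d' + e))) =
        2 ^ ((n : ℝ) * (s * d)) * 2 ^ ((n : ℝ) * (s * d')) * 2 ^ ((n : ℝ) * (s * e)) := by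
      rw [← Real.rpow_add (by norm_num), ← Real.rpow_add (by norm_num)]
      ring_nf
    rw [h5]
    have h6 : (0 : ℝ) ≤ ceilCard n (s * e) := Nat.cast_nonneg _
    linarith

/-- A time-sharing pattern with a prescribed fraction of forwarded first noise. -/
lemma exists_pattern (n : ℕ) {l : ℝ} (hl0 : 0 ≤ l) (hl1 : l ≤ 1) : ∃ A : Fin n → Bool,
    |((Finset.univ.filter fun t => A t = true).card : ℝ) - l * n| ≤ 1 ∧
    |((Finset.univ.filter fun t => (!A t) = true).card : ℝ) - (1 - l) * n| ≤ 1 := by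
  have hk : ⌊l * n⌋₊ ≤ n := Nat.floor_le_of_le (by nlinarith [Nat.cast_nonneg (α := ℝ) n])
  have hcard : (Finset.univ.filter fun t : Fin n => decide ((t : ℕ) < ⌊l * n⌋₊) = true).card =
      ⌊l * n⌋₊ := by
    simp only [decide_eq_true_eq, Fin.card_filter_val_lt]
    exact min_eq_right hk
  have h1 : |(⌊l * n⌋₊ : ℝ) - l * n| ≤ 1 := by
    have h2 := Nat.floor_le (mul_nonneg hl0 (Nat.cast_nonneg (α := ℝ) n))
    have h3 := Nat.lt_floor_add_one (l * (n : ℝ))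
    rw [abs_le]
    constructor <;> linarith
  refine ⟨fun t => decide ((t : ℕ) < ⌊l * n⌋₊), by rw [hcard]; exact h1, ?_⟩
  have hsum := Finset.card_filter_add_card_filter_not (s := (Finset.univ : Finset (Fin n)))
    fun t => decide ((t : ℕ) < ⌊l * n⌋₊) = true
  rw [hcard, Finset.card_univ, Fintype.card_fin] at hsum
  have hnot : (Finset.univ.filter fun t : Fin n => (!decide ((t : ℕ) < ⌊l * n⌋₊)) = true).card =
      (Finset.univ.filter fun t : Fin n => ¬decide ((t : ℕ) < ⌊l * n⌋₊) = true).card := by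
    congr 1
    ext t
    simp
  rw [hnot]
  have hsum' : (⌊l * n⌋₊ : ℝ) + (Finset.univ.filter fun t : Fin n =>
      ¬decide ((t : ℕ) < ⌊l * n⌋₊) = true).card = n := by exact_mod_cast hsum
  rw [abs_le] at h1 ⊢
  constructor <;> linarith

/-! ### Achievability -/

lemma entOf_swapLaw_fst (p : Bool × Bool × Bool → ℝ) :
    entOf (swapLaw p) (fun z => (z.1, z.2.1)) = entOf p fun z => (z.1, z.2.2) :=
  entOf_swapLaw p _

lemma entOf_swapLaw_snd (p : Bool × Bool × Bool → ℝ) :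
    entOf (swapLaw p) (fun z => (z.1, z.2.2)) = entOf p fun z => (z.1, z.2.1) :=
  entOf_swapLaw p _

lemma errProbFB_dueck_nonneg {PZ : Bool × Bool × Bool → ℝ} (hPZ : IsPMF PZ) {n : ℕ}
    {R0 R1 R2 : ℝ}
    (enc : Fin n → Fin (msgCard n R0) × Fin (msgCard n R1) × Fin (msgCard n R2) →
      (Fin n → (Bool × Bool) × Bool × Bool) → Bool × Bool × Bool)
    (dec1 : (Fin n → Bool × Bool) → Fin (msgCard n R0) × Fin (msgCard n R1))
    (dec2 : (Fin n → Bool × Bool) → Fin (msgCard n R0) × Fin (msgCard n R2)) :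
    0 ≤ errProbFB (noiselessExt (dueckW PZ)) n R0 R1 R2 enc dec1 dec2 := by
  rw [errProbFB_dueck]
  refine mul_nonneg (by positivity) (Finset.sum_nonneg fun m _ => Finset.sum_nonneg fun v _ =>
    mul_nonneg (Finset.prod_nonneg fun t _ => hPZ.1 _) ?_)
  split_ifs
  · exact zero_le_one
  · exact le_rfl

/-- A random codebook with independent letters for both receivers. -/
lemma exists_bookLaw (K₁ L₁ K₂ L₂ : Type*) [Fintype K₁] [Fintype L₁] [Fintype K₂] [Fintype L₂]
    (n : ℕ) : ∃ (_ : Fintype (BookLetter K₁ L₁ K₂ L₂ n)) (W : BookLetter K₁ L₁ K₂ L₂ n → ℝ),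
      IsPMF W ∧ IndepLetters W privBit₁ commonBit₁ ∧ IndepLetters W privBit₂ commonBit₂ :=
  ⟨_, letterLaw (K₁ × L₁) (K₂ × L₂) ((K₁ × K₂) × (Fin n → Bool)), isPMF_letterLaw _ _ _,
    indepLetters_fst _ _ _ (e := id) Function.injective_id,
    indepLetters_snd _ _ _
      (e := fun t : (K₂ × K₁) × (Fin n → Bool) => ((t.1.2, t.1.1), t.2)) fun x y h => by
        simp only [Prod.mk.injEq] at h
        exact Prod.ext (Prod.ext h.1.2 h.1.1) h.2⟩

/-- Rates scaled down from the outer bound are achievable. -/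
lemma achievableFB_smul {PZ : Bool × Bool × Bool → ℝ} (hPZ : IsPMF PZ)
    (h1 : entOf PZ (fun z => (z.1, z.2.1)) ≤ 1) (h2 : entOf PZ (fun z => (z.1, z.2.2)) ≤ 1)
    {r₁ r₂ s : ℝ} (hr₁0 : 0 ≤ r₁) (hr₂0 : 0 ≤ r₂)
    (hr₁ : r₁ ≤ 2 - entOf PZ (fun z => (z.1, z.2.1)))
    (hr₂ : r₂ ≤ 2 - entOf PZ (fun z => (z.1, z.2.2)))
    (hr : r₁ + r₂ ≤ 3 - entOf PZ (fun z => z)) (hs0 : 0 ≤ s) (hs1 : s < 1) :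
    AchievableFB (noiselessExt (dueckW PZ)) 0 (s * r₁) (s * r₂) := by
  have hHa := entOf_id_le_fst_add_one hPZ
  have hHb := entOf_id_le_snd_add_one hPZ
  have hS := isPMF_swapLaw hPZ
  have hS1 := entOf_swapLaw_fst PZ
  have hS2 := entOf_swapLaw_snd PZ
  have hS3 := entOf_swapLaw_id PZ
  obtain ⟨l, d₁, d₂, e₁, e₂, hl0, hl1, hd₁, hd₂, he₁, he₂, hde₁, hde₂, hE₁, hE₂, hD⟩ :=
    exists_rate_split h1 h2 hHa hHb hr₁0 hr₂0 hr₁ hr₂ hr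
  generalize ha : entOf PZ (fun z => (z.1, z.2.1)) = a at *
  generalize hb : entOf PZ (fun z => (z.1, z.2.2)) = b at *
  generalize hH : entOf PZ (fun z => z) = H at *
  obtain ⟨q₁, hq₁, hN₁⟩ := exists_joint_exponent hs0 hs1 hd₁ hd₂ he₁
    (V := l * (2 - a) + (1 - l) * (2 - H)) (by nlinarith)
  obtain ⟨q₁', hq₁', hN₁'⟩ := exists_private_exponent hs0 hs1 he₁ hE₁
  obtain ⟨q₂, hq₂, hN₂⟩ := exists_joint_exponent hs0 hs1 hd₂ hd₁ he₂
    (V := (1 - l) * (2 - b) + (1 - (1 - l)) * (2 - H)) (by nlinarith)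
  obtain ⟨q₂', hq₂', hN₂'⟩ := exists_private_exponent hs0 hs1 he₂
    (E := (1 - l) + (1 - (1 - l)) * (1 - H + a)) (by linarith)
  obtain ⟨B₁, hB₁, hbd₁⟩ := exists_vanishing_bound hPZ (l := l) (r := q₁) (r' := q₁')
    (by rwa [ha]) (by rwa [hb]) (by rwa [ha, hH]) (by rwa [hb, hH])
  obtain ⟨B₂, hB₂, hbd₂⟩ := exists_vanishing_bound hS (l := 1 - l) (r := q₂) (r' := q₂')
    (by rwa [hS1]) (by rwa [hS2]) (by rwa [hS1, hS3]) (by rwa [hS2, hS3])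
  have hs₁ : 0 ≤ s * r₁ := mul_nonneg hs0 hr₁0
  have hs₂ : 0 ≤ s * r₂ := mul_nonneg hs0 hr₂0
  have hcode : ∀ n : ℕ, ∃ enc : Fin n →
      Fin (msgCard n 0) × Fin (msgCard n (s * r₁)) × Fin (msgCard n (s * r₂)) →
        (Fin n → (Bool × Bool) × Bool × Bool) → Bool × Bool × Bool,
      ∃ dec1 : (Fin n → Bool × Bool) → Fin (msgCard n 0) × Fin (msgCard n (s * r₁)),
      ∃ dec2 : (Fin n → Bool × Bool) → Fin (msgCard n 0) × Fin (msgCard n (s * r₂)),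
        Causal n enc ∧ errProbFB (noiselessExt (dueckW PZ)) n 0 (s * r₁) (s * r₂) enc dec1 dec2 ≤
          B₁ n + B₂ n := by
    intro n
    have : NeZero (ceilCard n (s * d₁)) := ⟨(ceilCard_pos _ _).ne'⟩
    have : NeZero (ceilCard n (s * d₂)) := ⟨(ceilCard_pos _ _).ne'⟩
    have : NeZero (ceilCard n (s * e₁)) := ⟨(ceilCard_pos _ _).ne'⟩
    have : NeZero (ceilCard n (s * e₂)) := ⟨(ceilCard_pos _ _).ne'⟩
    have : Nonempty (Fin (msgCard n (s * r₁))) := ⟨⟨0, msgCard_pos n hs₁⟩⟩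
    have : Nonempty (Fin (msgCard n (s * r₂))) := ⟨⟨0, msgCard_pos n hs₂⟩⟩
    have : Nonempty (Fin (msgCard n 0)) := ⟨⟨0, msgCard_pos n le_rfl⟩⟩
    have hι₁ : Nonempty (Fin (msgCard n (s * r₁)) ↪
        Fin (ceilCard n (s * d₁)) × Fin (ceilCard n (s * e₁))) := by
      refine Function.Embedding.nonempty_of_card_le ?_
      simp only [Fintype.card_prod, Fintype.card_fin]
      rw [← hde₁, mul_add]
      exact msgCard_le_ceilCard_mul n _ _
    have hι₂ : Nonempty (Fin (msgCard n (s * r₂)) ↪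
        Fin (ceilCard n (s * d₂)) × Fin (ceilCard n (s * e₂))) := by
      refine Function.Embedding.nonempty_of_card_le ?_
      simp only [Fintype.card_prod, Fintype.card_fin]
      rw [← hde₂, mul_add]
      exact msgCard_le_ceilCard_mul n _ _
    obtain ⟨ι₁⟩ := hι₁
    obtain ⟨ι₂⟩ := hι₂
    obtain ⟨A, hA, hA'⟩ := exists_pattern n hl0 hl1
    obtain ⟨_, W, hWp, hind₁, hind₂⟩ := exists_bookLaw (Fin (ceilCard n (s * d₁)))
      (Fin (ceilCard n (s * e₁))) (Fin (ceilCard n (s * d₂))) (Fin (ceilCard n (s * e₂))) n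
    have hav : ∑ γ : Fin n → BookLetter _ _ _ _ n, (∏ t, W (γ t)) *
        ∑ m, unif (Fin (msgCard n 0) × Fin (msgCard n (s * r₁)) × Fin (msgCard n (s * r₂))) m *
          (bookErr₁ PZ A γ (ι₁ m.2.1) (ι₂ m.2.2).1 + bookErr₂ PZ A γ (ι₂ m.2.2) (ι₁ m.2.1).1) ≤
        B₁ n + B₂ n := by
      refine sum_mul_sum_mul_le_of_forall (isPMF_unif _) fun m => ?_
      simp only [mul_add, Finset.sum_add_distrib]
      refine add_le_add ?_ ?_
      · refine hbd₁ n _ _ _ _ W hWp privBit₁ commonBit₁ hind₁ A _ _ hA ?_ ?_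
        · simpa only [Fintype.card_fin] using hN₁ n
        · simpa only [Fintype.card_fin] using hN₁' n
      · refine hbd₂ n _ _ _ _ W hWp privBit₂ commonBit₂ hind₂ (fun t => !A t) _ _ hA' ?_ ?_
        · simpa only [Fintype.card_fin] using hN₂ n
        · simpa only [Fintype.card_fin] using hN₂' n
    obtain ⟨γ, hγ⟩ := (hWp.pi n).exists_le hav
    obtain ⟨enc, dec1, dec2, hc, herr⟩ := exists_code hPZ hs₁ hs₂ ι₁ ι₂ A γ
    exact ⟨enc, dec1, dec2, hc, herr.trans hγ⟩
  choose enc dec1 dec2 hc herr using hcode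
  refine ⟨le_rfl, hs₁, hs₂, enc, dec1, dec2, hc, ?_⟩
  refine squeeze_zero (fun n => errProbFB_dueck_nonneg hPZ _ _ _) herr ?_
  simpa using hB₁.add hB₂

end BCFB

namespace BCFB

/-- **Theorem 4.** Noiseless-feedback capacity of the generalized Dueck DMBC
(zero common rate slice), under `H(Z₀,Z₁) ≤ 1` and `H(Z₀,Z₂) ≤ 1`. -/
theorem dueck_noiselessFB_capacity (PZ : Bool × Bool × Bool → ℝ) (hPZ : IsPMF PZ)
    (h1 : entOf PZ (fun z => (z.1, z.2.1)) ≤ 1)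
    (h2 : entOf PZ (fun z => (z.1, z.2.2)) ≤ 1) :
    {r : ℝ × ℝ | (0, r.1, r.2) ∈ CNoiselessFB (dueckW PZ)} =
      {r : ℝ × ℝ | 0 ≤ r.1 ∧ 0 ≤ r.2 ∧
        r.1 ≤ 2 - entOf PZ (fun z => (z.1, z.2.1)) ∧
        r.2 ≤ 2 - entOf PZ (fun z => (z.1, z.2.2)) ∧
        r.1 + r.2 ≤ 3 - entOf PZ (fun z => z)} := by
  ext ⟨r₁, r₂⟩
  simp only [Set.mem_ofPred_eq]
  constructor
  · intro h
    have hclosed : IsClosed {r : ℝ × ℝ × ℝ | 0 ≤ r.2.1 ∧ 0 ≤ r.2.2 ∧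
        r.2.1 ≤ 2 - entOf PZ (fun z => (z.1, z.2.1)) ∧
        r.2.2 ≤ 2 - entOf PZ (fun z => (z.1, z.2.2)) ∧
        r.2.1 + r.2.2 ≤ 3 - entOf PZ (fun z => z)} := by
      have hc₁ : Continuous fun r : ℝ × ℝ × ℝ => r.2.1 := by fun_prop
      have hc₂ : Continuous fun r : ℝ × ℝ × ℝ => r.2.2 := by fun_prop
      exact (isClosed_le continuous_const hc₁).inter ((isClosed_le continuous_const hc₂).inter
        ((isClosed_le hc₁ continuous_const).inter ((isClosed_le hc₂ continuous_const).inter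
          (isClosed_le (hc₁.add hc₂) continuous_const))))
    exact closure_minimal (s := {r : ℝ × ℝ × ℝ |
        AchievableFB (noiselessExt (dueckW PZ)) r.1 r.2.1 r.2.2})
      (fun _ hr => And.intro hr.2.1 (And.intro hr.2.2.1 (AchievableFB.rates_le hPZ hr)))
      hclosed h
  · rintro ⟨hr₁0, hr₂0, hr₁, hr₂, hr⟩
    have hlim : Filter.Tendsto (fun s : ℝ => ((0 : ℝ), s * r₁, s * r₂))
        (nhdsWithin 1 (Set.Iio 1)) (nhds (0, r₁, r₂)) := by
      have hcont : Continuous fun s : ℝ => ((0 : ℝ), s * r₁, s * r₂) := by fun_prop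
      have := hcont.tendsto 1
      simp only [one_mul] at this
      exact this.mono_left nhdsWithin_le_nhds
    refine mem_closure_of_tendsto hlim ?_
    filter_upwards [Ioo_mem_nhdsLT (show (0 : ℝ) < 1 by norm_num)] with s hs
    exact achievableFB_smul hPZ h1 h2 hr₁0 hr₂0 hr₁ hr₂ hr hs.1.le hs.2

end BCFB
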